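/- Let K be an imaginary quadratic field with ring of integers O_K, class number h_K, and associated quadratic Dirichlet character χ = (Δ_K/·) where Δ_K is the discriminant of K. Let γ denote the Euler–Mascheroni constant. Then, as nonzero ideals 𝔞 of O_K range over ideals with |𝔞| → ∞, liminf φ_K(𝔞) · log log |𝔞| / |𝔞| = e^{−γ} · L(1, χ)^{−1}. -/

import Mathlib

open NumberField

/-- The Kronecker symbol `(Δ/p)` at a prime `p` (agreeing with the Legendre/Jacobi symbol at
odd primes, with the usual convention at `p = 2`). -/
def kroneckerAtPrime (Δ : ℤ) (p : ℕ) : ℤ :=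
  if p = 2 then (if Δ % 2 = 0 then 0 else if Δ % 8 = 1 ∨ Δ % 8 = 7 then 1 else -1)
  else jacobiSym Δ p

/-- The Kronecker symbol `(Δ/n)` for `n ≥ 1`, extended completely multiplicatively from its
values at primes. -/
def kroneckerChar (Δ : ℤ) (n : ℕ) : ℤ :=
  n.factorization.prod fun p k => (kroneckerAtPrime Δ p) ^ k

section

open Filter Topology

/-- The weighted point masses `w i` at `ℓ i` have a Laplace transform that behaves like
`-log δ + c` as `δ → 0⁺`. -/
structure LogLaplace {ι : Type*} (w ℓ : ι → ℝ) (c : ℝ) : Prop where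
  weight_nonneg : ∀ i, 0 ≤ w i
  point_nonneg : ∀ i, 0 ≤ ℓ i
  summable : ∀ δ > 0, Summable fun i => w i * Real.exp (-(δ * ℓ i))
  tendsto : Tendsto (fun δ => ∑' i, w i * Real.exp (-(δ * ℓ i)) + Real.log δ) (𝓝[>] 0) (𝓝 c)

namespace LogLaplace

variable {ι κ : Type*} {w ℓ : ι → ℝ} {v m : κ → ℝ} {c d : ℝ}

/-- The integral of `f (exp (-δ ℓ))` against the point masses. -/
noncomputable def testSum (w ℓ : ι → ℝ) (f : ℝ → ℝ) (δ : ℝ) : ℝ :=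
  ∑' i, w i * f (Real.exp (-(δ * ℓ i)))

/-- The total mass located in `(-∞, y]`. -/
noncomputable def mass (w ℓ : ι → ℝ) (y : ℝ) : ℝ :=
  ∑' i, if ℓ i ≤ y then w i else 0

theorem exp_mem (h : LogLaplace w ℓ c) {δ : ℝ} (hδ : 0 < δ) (i : ι) :
    Real.exp (-(δ * ℓ i)) ∈ Set.Icc (0 : ℝ) 1 :=
  ⟨(Real.exp_pos _).le, Real.exp_le_one_iff.2 (neg_nonpos.2 (mul_nonneg hδ.le (h.point_nonneg i)))⟩

theorem summable_test (h : LogLaplace w ℓ c) {f : ℝ → ℝ} {C : ℝ}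
    (hf : ∀ u ∈ Set.Icc (0 : ℝ) 1, |f u| ≤ C * u) {δ : ℝ} (hδ : 0 < δ) :
    Summable fun i => w i * f (Real.exp (-(δ * ℓ i))) := by
  refine Summable.of_norm_bounded ((h.summable δ hδ).mul_left C) fun i => ?_
  rw [Real.norm_eq_abs, abs_mul, abs_of_nonneg (h.weight_nonneg i)]
  have := mul_le_mul_of_nonneg_left (hf _ (h.exp_mem hδ i)) (h.weight_nonneg i)
  linarith

theorem summable_mass (h : LogLaplace w ℓ c) (y : ℝ) :
    Summable fun i => if ℓ i ≤ y then w i else 0 := by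
  refine Summable.of_nonneg_of_le (fun i => ?_) (fun i => ?_)
    ((h.summable 1 one_pos).mul_left (Real.exp y))
  · split_ifs
    · exact h.weight_nonneg i
    · exact le_rfl
  · have hw := h.weight_nonneg i
    split_ifs with hy
    · rw [mul_left_comm, ← Real.exp_add]
      exact le_mul_of_one_le_right hw (Real.one_le_exp (by linarith))
    · positivity

theorem tendsto_dilate (h : LogLaplace w ℓ c) {a : ℝ} (ha : 0 < a) :
    Tendsto (fun δ => ∑' i, w i * Real.exp (-((a * δ) * ℓ i)) + Real.log δ) (𝓝[>] 0)
      (𝓝 (c - Real.log a)) := by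
  have h1 : Tendsto (fun δ : ℝ => a * δ) (𝓝[>] 0) (𝓝[>] 0) := by
    refine tendsto_nhdsWithin_iff.2 ⟨?_, ?_⟩
    · have : Tendsto (fun δ : ℝ => a * δ) (𝓝 0) (𝓝 (a * 0)) := tendsto_id.const_mul a
      rw [mul_zero] at this
      exact this.mono_left nhdsWithin_le_nhds
    · filter_upwards [self_mem_nhdsWithin] with δ hδ
      exact mul_pos ha hδ
  refine ((h.tendsto.comp h1).sub_const (Real.log a)).congr' ?_
  filter_upwards [self_mem_nhdsWithin] with δ hδ
  have : Real.log (a * δ) = Real.log a + Real.log δ := Real.log_mul ha.ne' (ne_of_gt hδ)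
  simp only [Function.comp_apply]
  rw [this]
  ring

theorem testSum_mul_polynomial (h : LogLaplace w ℓ c) (r : Polynomial ℝ) {δ : ℝ} (hδ : 0 < δ) :
    testSum w ℓ (fun u => u * r.eval u) δ =
      ∑ k ∈ Finset.range (r.natDegree + 1),
        r.coeff k * ∑' i, w i * Real.exp (-(((k + 1 : ℝ) * δ) * ℓ i)) := by
  have hs : ∀ k : ℕ, Summable fun i => w i * Real.exp (-(((k + 1 : ℝ) * δ) * ℓ i)) :=
    fun k => h.summable _ (by positivity)
  simp_rw [← tsum_mul_left]
  rw [← Summable.tsum_finsetSum fun k _ => (hs k).mul_left _]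
  refine tsum_congr fun i => ?_
  beta_reduce
  rw [Polynomial.eval_eq_sum_range, Finset.mul_sum, Finset.mul_sum]
  refine Finset.sum_congr rfl fun k _ => ?_
  rw [← Real.exp_nat_mul, show -((k + 1 : ℝ) * δ * ℓ i) = -(δ * ℓ i) + k * -(δ * ℓ i) by ring,
    Real.exp_add]
  ring

theorem tendsto_sub_polynomial (h : LogLaplace w ℓ c) (h' : LogLaplace v m d)
    (r : Polynomial ℝ) :
    Tendsto (fun δ => testSum w ℓ (fun u => u * r.eval u) δ -
      testSum v m (fun u => u * r.eval u) δ) (𝓝[>] 0) (𝓝 (r.eval 1 * (c - d))) := by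
  have key : Tendsto (fun δ : ℝ => ∑ k ∈ Finset.range (r.natDegree + 1),
      r.coeff k * ((∑' i, w i * Real.exp (-(((k + 1 : ℝ) * δ) * ℓ i)) + Real.log δ) -
        (∑' i, v i * Real.exp (-(((k + 1 : ℝ) * δ) * m i)) + Real.log δ))) (𝓝[>] 0)
      (𝓝 (∑ k ∈ Finset.range (r.natDegree + 1), r.coeff k *
        ((c - Real.log (k + 1)) - (d - Real.log (k + 1))))) :=
    tendsto_finsetSum _ fun k _ => ((h.tendsto_dilate (by positivity)).sub
      (h'.tendsto_dilate (by positivity))).const_mul _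
  have e : ∑ k ∈ Finset.range (r.natDegree + 1), r.coeff k *
        ((c - Real.log (k + 1)) - (d - Real.log (k + 1))) = r.eval 1 * (c - d) := by
    rw [Polynomial.eval_eq_sum_range, Finset.sum_mul]
    exact Finset.sum_congr rfl fun k _ => by ring
  rw [e] at key
  refine key.congr' ?_
  filter_upwards [self_mem_nhdsWithin] with δ hδ
  rw [h.testSum_mul_polynomial r hδ, h'.testSum_mul_polynomial r hδ, ← Finset.sum_sub_distrib]
  exact Finset.sum_congr rfl fun k _ => by ring

theorem tendsto_testSum_bump (h : LogLaplace w ℓ c) :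
    Tendsto (testSum w ℓ fun u => u * (1 - u)) (𝓝[>] 0) (𝓝 (Real.log 2)) := by
  have h1 := (h.tendsto_dilate one_pos).sub (h.tendsto_dilate two_pos)
  rw [show c - Real.log 1 - (c - Real.log 2) = Real.log 2 by simp] at h1
  refine h1.congr' ?_
  filter_upwards [self_mem_nhdsWithin] with δ hδ
  rw [add_sub_add_right_eq_sub, ← Summable.tsum_sub (h.summable _ (by simpa using hδ))
    (h.summable _ (mul_pos two_pos hδ))]
  refine tsum_congr fun i => ?_
  rw [show -(2 * δ * ℓ i) = -(δ * ℓ i) + -(δ * ℓ i) by ring, Real.exp_add, one_mul]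
  ring

theorem abs_testSum_sub_le (h : LogLaplace w ℓ c) {f g : ℝ → ℝ} {A B ε : ℝ}
    (hf : ∀ u ∈ Set.Icc (0 : ℝ) 1, |f u| ≤ A * u) (hg : ∀ u ∈ Set.Icc (0 : ℝ) 1, |g u| ≤ B * u)
    (hfg : ∀ u ∈ Set.Icc (0 : ℝ) 1, |f u - g u| ≤ ε * (u * (1 - u))) {δ : ℝ} (hδ : 0 < δ) :
    |testSum w ℓ f δ - testSum w ℓ g δ| ≤ ε * testSum w ℓ (fun u => u * (1 - u)) δ := by
  have hbump : ∀ u ∈ Set.Icc (0 : ℝ) 1, |u * (1 - u)| ≤ 1 * u := by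
    intro u hu
    rw [abs_of_nonneg (mul_nonneg hu.1 (by linarith [hu.2]))]
    nlinarith [hu.1, hu.2]
  unfold testSum
  rw [← Summable.tsum_sub (h.summable_test hf hδ) (h.summable_test hg hδ), ← tsum_mul_left]
  refine tsum_of_norm_bounded (f := fun i => w i * f (Real.exp (-(δ * ℓ i))) -
    w i * g (Real.exp (-(δ * ℓ i)))) ((h.summable_test hbump hδ).mul_left _).hasSum fun i => ?_
  rw [← mul_sub, Real.norm_eq_abs, abs_mul, abs_of_nonneg (h.weight_nonneg i), mul_left_comm]
  exact mul_le_mul_of_nonneg_left (hfg _ (h.exp_mem hδ i)) (h.weight_nonneg i)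

/-- Convergence of the difference of the two test sums for test functions of the form
`u + u (1 - u) k u` with `k` continuous, by Weierstrass approximation. -/
theorem tendsto_sub_continuous (h : LogLaplace w ℓ c) (h' : LogLaplace v m d)
    {k : ℝ → ℝ} (hk : ContinuousOn k (Set.Icc 0 1)) :
    Tendsto (fun δ => testSum w ℓ (fun u => u + u * (1 - u) * k u) δ -
      testSum v m (fun u => u + u * (1 - u) * k u) δ) (𝓝[>] 0) (𝓝 (c - d)) := by
  obtain ⟨M, hM⟩ := isCompact_Icc.exists_bound_of_continuousOn hk
  have hbd : ∀ u ∈ Set.Icc (0 : ℝ) 1, |u + u * (1 - u) * k u| ≤ (1 + M) * u := by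
    intro u hu
    have h1 : |k u| ≤ M := hM u hu
    have h2 : 0 ≤ u * (1 - u) := mul_nonneg hu.1 (by linarith [hu.2])
    calc |u + u * (1 - u) * k u| ≤ |u| + |u * (1 - u) * k u| := abs_add_le _ _
      _ = u + u * (1 - u) * |k u| := by rw [abs_mul, abs_of_nonneg h2, abs_of_nonneg hu.1]
      _ ≤ u + u * 1 * M := by
        have := (abs_nonneg _).trans h1
        have := hu.1
        gcongr
        linarith
      _ = (1 + M) * u := by ring
  rw [Metric.tendsto_nhds]
  intro ε hε
  obtain ⟨r, hr⟩ := exists_polynomial_near_of_continuousOn 0 1 k hk (ε / 6) (by positivity)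
  obtain ⟨C, hC⟩ := isCompact_Icc.exists_bound_of_continuousOn
    (s := Set.Icc (0 : ℝ) 1) (f := fun u => (1 + (1 - Polynomial.X) * r : Polynomial ℝ).eval u)
    (Polynomial.continuous _).continuousOn
  have hpoly : ∀ u ∈ Set.Icc (0 : ℝ) 1,
      |u * (1 + (1 - Polynomial.X) * r : Polynomial ℝ).eval u| ≤ C * u := by
    intro u hu
    rw [abs_mul, abs_of_nonneg hu.1, mul_comm]
    exact mul_le_mul_of_nonneg_right (hC u hu) hu.1
  have hclose : ∀ u ∈ Set.Icc (0 : ℝ) 1, |u + u * (1 - u) * k u -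
      u * (1 + (1 - Polynomial.X) * r : Polynomial ℝ).eval u| ≤ ε / 6 * (u * (1 - u)) := by
    intro u hu
    have h2 : 0 ≤ u * (1 - u) := mul_nonneg hu.1 (by linarith [hu.2])
    have : u + u * (1 - u) * k u - u * (1 + (1 - Polynomial.X) * r : Polynomial ℝ).eval u =
        -((u * (1 - u)) * (r.eval u - k u)) := by
      simp only [Polynomial.eval_add, Polynomial.eval_mul, Polynomial.eval_sub,
        Polynomial.eval_one, Polynomial.eval_X]
      ring
    rw [this, abs_neg, abs_mul, abs_of_nonneg h2, mul_comm]
    exact mul_le_mul_of_nonneg_right (hr u hu).le h2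
  have hlim := h.tendsto_sub_polynomial h' (1 + (1 - Polynomial.X) * r)
  rw [show (1 + (1 - Polynomial.X) * r : Polynomial ℝ).eval 1 * (c - d) = c - d by simp] at hlim
  have hlog2 : Real.log 2 < 1 := by linarith [Real.log_two_lt_d9]
  filter_upwards [self_mem_nhdsWithin, Metric.tendsto_nhds.1 hlim (ε / 2) (by positivity),
    h.tendsto_testSum_bump.eventually_lt_const hlog2,
    h'.tendsto_testSum_bump.eventually_lt_const hlog2] with δ hδ h1 h2 h3
  have c1 := h.abs_testSum_sub_le hbd hpoly hclose hδ
  have c2 := h'.abs_testSum_sub_le hbd hpoly hclose hδ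
  rw [Real.dist_eq] at h1 ⊢
  rw [abs_le] at c1 c2
  rw [abs_lt] at h1 ⊢
  have : ε / 6 * testSum w ℓ (fun u => u * (1 - u)) δ ≤ ε / 6 * 1 := by gcongr
  have : ε / 6 * testSum v m (fun u => u * (1 - u)) δ ≤ ε / 6 * 1 := by gcongr
  constructor <;> linarith

theorem eventually_mass_le (h : LogLaplace w ℓ c) (h' : LogLaplace v m d) {η ε : ℝ}
    (hη : 0 < η) (hε : 0 < ε) :
    ∀ᶠ y in atTop, mass w ℓ y ≤ mass v m ((1 + η) * y) + (c - d) + ε := by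
  set a := Real.exp (-(1 + η)) with ha
  set b := Real.exp (-1) with hb
  have hab : a < b := Real.exp_lt_exp.2 (by linarith)
  have ha0 : 0 < a := Real.exp_pos _
  have hb1 : b < 1 := Real.exp_lt_one_iff.2 (by norm_num)
  set g : ℝ → ℝ := fun u => max 0 (min 1 ((u - a) / (b - a))) with hg
  have g0 : ∀ u, 0 ≤ g u := fun u => le_max_left _ _
  have g1 : ∀ u, g u ≤ 1 := fun u => max_le zero_le_one (min_le_left _ _)
  have ga : ∀ u ≤ a, g u = 0 := fun u hu => max_eq_left <| (min_le_right _ _).trans <|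
    div_nonpos_of_nonpos_of_nonneg (by linarith) (by linarith)
  have gb : ∀ u, b ≤ u → g u = 1 := fun u hu => by
    have : 1 ≤ (u - a) / (b - a) := by rw [le_div_iff₀ (by linarith)]; linarith
    simp [hg, min_eq_left this]
  set k : ℝ → ℝ := fun u => g u / max u a - (1 - g u) / max (1 - u) (1 - b) with hkdef
  have hgc : Continuous g := by fun_prop
  have hkc : Continuous k := by
    refine (hgc.div (by fun_prop) fun u => ?_).sub ((continuous_const.sub hgc).div
      (by fun_prop) fun u => ?_)
    · exact (lt_of_lt_of_le ha0 (le_max_right _ _)).ne'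
    · exact (lt_of_lt_of_le (by linarith) (le_max_right (1 - u) (1 - b))).ne'
  have hgk : (fun u => u + u * (1 - u) * k u) = g := by
    funext u
    simp only [hkdef]
    rcases le_total u a with hu | hu
    · rw [ga u hu, max_eq_left (show 1 - b ≤ 1 - u by linarith)]
      have : 1 - u ≠ 0 := by linarith
      field_simp
      ring
    · rw [max_eq_left hu]
      have hu0 : u ≠ 0 := by linarith
      rcases le_total u b with hub | hub
      · rw [max_eq_left (show 1 - b ≤ 1 - u by linarith)]
        have : 1 - u ≠ 0 := by linarith
        field_simp
        ring
      · rw [gb u hub]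
        field_simp
        ring
  have hgbd : ∀ u ∈ Set.Icc (0 : ℝ) 1, |g u| ≤ a⁻¹ * u := by
    intro u hu
    rw [abs_of_nonneg (g0 u)]
    rcases le_total u a with h2 | h2
    · rw [ga u h2]; exact mul_nonneg (by positivity) hu.1
    · refine (g1 u).trans ?_
      rw [← div_eq_inv_mul, le_div_iff₀ ha0]; linarith
  have hlim := h.tendsto_sub_continuous h' hkc.continuousOn
  rw [hgk] at hlim
  filter_upwards [eventually_gt_atTop 0, (hlim.comp tendsto_inv_atTop_nhdsGT_zero).eventually_lt_const
    (show c - d < c - d + ε by linarith)] with y hy hyd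
  simp only [Function.comp_apply] at hyd
  have hy' : 0 < y⁻¹ := inv_pos.2 hy
  have l1 : mass w ℓ y ≤ testSum w ℓ g y⁻¹ := by
    refine (h.summable_mass y).tsum_le_tsum (fun i => ?_) (h.summable_test hgbd hy')
    split_ifs with hi
    · rw [gb, mul_one]
      refine Real.exp_le_exp.2 (neg_le_neg ?_)
      rw [← div_eq_inv_mul, div_le_one hy]
      exact hi
    · exact mul_nonneg (h.weight_nonneg i) (g0 _)
  have l2 : testSum v m g y⁻¹ ≤ mass v m ((1 + η) * y) := by
    refine (h'.summable_test hgbd hy').tsum_le_tsum (fun i => ?_) (h'.summable_mass _)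
    split_ifs with hi
    · exact mul_le_of_le_one_right (h'.weight_nonneg i) (g1 _)
    · rw [ga, mul_zero]
      refine Real.exp_le_exp.2 (neg_le_neg ?_)
      rw [← div_eq_inv_mul, le_div_iff₀ hy]
      exact (not_le.1 hi).le
  linarith

theorem harmonic_model : LogLaplace (fun n : ℕ => ((n : ℝ) + 1)⁻¹) (fun n => (n : ℝ) + 1) 0 := by
  have hs : ∀ δ > 0, HasSum (fun n : ℕ => ((n : ℝ) + 1)⁻¹ * Real.exp (-(δ * ((n : ℝ) + 1))))
      (-Real.log (1 - Real.exp (-δ))) := by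
    intro δ hδ
    have := Real.hasSum_pow_div_log_of_abs_lt_one (x := Real.exp (-δ))
      (by rw [abs_of_pos (Real.exp_pos _)]; exact Real.exp_lt_one_iff.2 (by linarith))
    refine this.congr_fun ?_
    intro n
    rw [← Real.exp_nat_mul, div_eq_inv_mul]
    push_cast
    ring_nf
  refine ⟨fun n => by positivity, fun n => by positivity, fun δ hδ => (hs δ hδ).summable, ?_⟩
  have hd : Tendsto (fun δ : ℝ => (1 - Real.exp (-δ)) / δ) (𝓝[>] 0) (𝓝 1) := by
    have : HasDerivAt (fun δ : ℝ => 1 - Real.exp (-δ)) 1 0 := by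
      have := ((Real.hasDerivAt_exp (-0)).comp (0 : ℝ) (hasDerivAt_neg (0 : ℝ))).const_sub 1
      simpa using this
    have h2 := hasDerivAt_iff_tendsto_slope.1 this
    refine (h2.mono_left (nhdsWithin_mono _ fun x hx => ne_of_gt hx)).congr fun δ => ?_
    simp [slope_def_field]
  have := (Real.continuousAt_log one_ne_zero).tendsto.comp hd
  rw [Real.log_one] at this
  have := this.neg
  rw [neg_zero] at this
  refine this.congr' ?_
  filter_upwards [self_mem_nhdsWithin] with δ hδ
  have hδ : 0 < δ := hδ
  have : 0 < 1 - Real.exp (-δ) := by linarith [Real.exp_lt_one_iff.2 (show -δ < 0 by linarith)]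
  rw [(hs δ hδ).tsum_eq, Function.comp_apply, Real.log_div this.ne' hδ.ne']
  ring

theorem tendsto_harmonic_mass :
    Tendsto (fun y => mass (fun n : ℕ => ((n : ℝ) + 1)⁻¹) (fun n => (n : ℝ) + 1) y - Real.log y)
      atTop (𝓝 Real.eulerMascheroniConstant) := by
  have e : ∀ y : ℝ, 0 ≤ y → mass (fun n : ℕ => ((n : ℝ) + 1)⁻¹) (fun n => (n : ℝ) + 1) y =
      (harmonic ⌊y⌋₊ : ℝ) := by
    intro y hy
    have hiff : ∀ n : ℕ, (n : ℝ) + 1 ≤ y ↔ n ∈ Finset.range ⌊y⌋₊ := fun n => by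
      rw [Finset.mem_range, ← Nat.add_one_le_iff, Nat.le_floor_iff hy]
      push_cast
      rfl
    unfold mass harmonic
    rw [tsum_eq_sum (s := Finset.range ⌊y⌋₊)]
    · push_cast
      refine Finset.sum_congr rfl fun n hn => ?_
      rw [if_pos ((hiff n).2 hn)]
    · intro n hn
      rw [if_neg fun hh => hn ((hiff n).1 hh)]
  have h1 := Real.tendsto_harmonic_sub_log.comp tendsto_nat_floor_atTop (α := ℝ)
  have h2 : Tendsto (fun y : ℝ => Real.log ((⌊y⌋₊ : ℝ) / y)) atTop (𝓝 0) := by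
    have := (Real.continuousAt_log one_ne_zero).tendsto.comp
      (tendsto_nat_floor_div_atTop (R := ℝ))
    rwa [Real.log_one] at this
  have h3 := h1.add h2
  rw [add_zero] at h3
  refine h3.congr' ?_
  filter_upwards [eventually_ge_atTop 1] with y hy
  have hf : (0 : ℝ) < ⌊y⌋₊ := by exact_mod_cast Nat.floor_pos.2 hy
  rw [e y (by linarith), Function.comp_apply, Real.log_div hf.ne' (by linarith)]
  ring

/-- A Tauberian theorem for the class of de Haan: the mass up to `y` is `log y + c + γ + o(1)`. -/
theorem tendsto_mass (h : LogLaplace w ℓ c) :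
    Tendsto (fun y => mass w ℓ y - Real.log y) atTop
      (𝓝 (c + Real.eulerMascheroniConstant)) := by
  set γ := Real.eulerMascheroniConstant
  rw [Metric.tendsto_nhds]
  intro ε hε
  set η := ε / 3 with hηd
  have hη : 0 < η := by positivity
  have hlogη : Real.log (1 + η) ≤ η := by
    have := Real.log_le_sub_one_of_pos (show 0 < 1 + η by linarith)
    linarith
  have s1 : Tendsto (fun y : ℝ => (1 + η) * y) atTop atTop :=
    tendsto_id.const_mul_atTop (by linarith)
  have s2 : Tendsto (fun y : ℝ => y / (1 + η)) atTop atTop :=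
    tendsto_id.atTop_div_const (by linarith)
  filter_upwards [h.eventually_mass_le harmonic_model hη hη,
    s2.eventually (harmonic_model.eventually_mass_le h hη hη),
    (tendsto_harmonic_mass.comp s1).eventually_lt_const (show γ < γ + η by linarith),
    (tendsto_harmonic_mass.comp s2).eventually_const_lt (show γ - η < γ by linarith),
    eventually_gt_atTop 0] with y h1 h2 h3 h4 hy
  simp only [Function.comp_apply] at h3 h4
  rw [Real.log_mul (by linarith) hy.ne'] at h3
  rw [Real.log_div hy.ne' (by linarith)] at h4
  rw [mul_div_cancel₀ _ (show (1 + η) ≠ 0 by linarith)] at h2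
  rw [Real.dist_eq, abs_lt]
  constructor <;> linarith

end LogLaplace

section QuadraticOrder

variable {K : Type*} [Field K] [NumberField K]

/-- The ring of integers of a quadratic field has a basis `1, θ`. -/
theorem exists_basis_one_generator (hdeg : Module.finrank ℚ K = 2) :
    ∃ b : Module.Basis (Fin 2) ℤ (𝓞 K), b 0 = 1 := by
  have hfr : Module.finrank ℤ (𝓞 K) = 2 := by rw [RingOfIntegers.rank, hdeg]
  let b := Module.finBasisOfFinrankEq ℤ (𝓞 K) hfr
  obtain ⟨x, y, h1⟩ : ∃ x y : ℤ, (1 : 𝓞 K) = x • b 0 + y • b 1 := by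
    have := b.sum_repr 1
    rw [Fin.sum_univ_two] at this
    exact ⟨_, _, this.symm⟩
  have hg : IsCoprime x y := by
    rw [Int.isCoprime_iff_gcd_eq_one]
    have hgx := Int.gcd_dvd_left (a := x) (b := y)
    have hgy := Int.gcd_dvd_right (a := x) (b := y)
    generalize Int.gcd x y = g at hgx hgy ⊢
    obtain ⟨x', rfl⟩ := hgx
    obtain ⟨y', rfl⟩ := hgy
    have h2 : algebraMap ℤ (𝓞 K) g * (x' • b 0 + y' • b 1) = 1 := by
      rw [h1]
      simp only [zsmul_eq_mul, eq_intCast]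
      push_cast
      ring
    have h4 := (IsUnit.of_mul_eq_one _ h2).map (Algebra.norm ℤ)
    rw [Algebra.norm_algebraMap, hfr, isUnit_pow_iff two_ne_zero] at h4
    simpa using Int.isUnit_iff_natAbs_eq.1 h4
  obtain ⟨u, v, huv⟩ := hg
  set θ : 𝓞 K := -v • b 0 + u • b 1 with hθ
  have huv' : (u : 𝓞 K) * x + v * y = 1 := by exact_mod_cast congrArg (Int.cast : ℤ → 𝓞 K) huv
  have e0 : b 0 = u • (1 : 𝓞 K) + (-y) • θ := by
    rw [hθ, h1]
    simp only [zsmul_eq_mul]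
    push_cast
    linear_combination (-b 0) * huv'
  have e1 : b 1 = v • (1 : 𝓞 K) + x • θ := by
    rw [hθ, h1]
    simp only [zsmul_eq_mul]
    push_cast
    linear_combination (-b 1) * huv'
  have hspan : ⊤ ≤ Submodule.span ℤ (Set.range ![(1 : 𝓞 K), θ]) := by
    have m0 : (1 : 𝓞 K) ∈ Submodule.span ℤ (Set.range ![(1 : 𝓞 K), θ]) :=
      Submodule.subset_span ⟨0, rfl⟩
    have m1 : θ ∈ Submodule.span ℤ (Set.range ![(1 : 𝓞 K), θ]) :=
      Submodule.subset_span ⟨1, rfl⟩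
    rw [← b.span_eq, Submodule.span_le]
    rintro _ ⟨i, rfl⟩
    fin_cases i
    · change b 0 ∈ _
      rw [e0]
      exact add_mem (Submodule.smul_mem _ _ m0) (Submodule.smul_mem _ _ m1)
    · change b 1 ∈ _
      rw [e1]
      exact add_mem (Submodule.smul_mem _ _ m0) (Submodule.smul_mem _ _ m1)
  exact ⟨basisOfTopLeSpanOfCardEqFinrank _ hspan (by simp [hfr]), by simp⟩

/-- The ring of integers of a quadratic field is generated by a root of
`X ^ 2 - t X + n`, where `t ^ 2 - 4 n` is the discriminant. -/
theorem exists_monogenic (hdeg : Module.finrank ℚ K = 2) :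
    ∃ (θ : 𝓞 K) (t n : ℤ), discr K = t ^ 2 - 4 * n ∧ RingOfIntegers.exponent θ = 1 ∧
      minpoly ℤ θ = Polynomial.X ^ 2 - Polynomial.C t * Polynomial.X + Polynomial.C n := by
  obtain ⟨b, hb⟩ := exists_basis_one_generator hdeg
  have hfr : Module.finrank ℤ (𝓞 K) = 2 := by rw [RingOfIntegers.rank, hdeg]
  obtain ⟨n, t, h⟩ : ∃ n t : ℤ, b 1 * b 1 = t • b 1 - n • 1 := by
    have := b.sum_repr (b 1 * b 1)
    rw [Fin.sum_univ_two, hb] at this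
    generalize b.repr (b 1 * b 1) 0 = n at this
    generalize b.repr (b 1 * b 1) 1 = t at this
    exact ⟨-n, t, by rw [← this]; module⟩
  have hmat : Algebra.leftMulMatrix b (b 1) = !![0, -n; 1, t] := by
    ext i j
    rw [Algebra.leftMulMatrix_eq_repr_mul]
    fin_cases j
    · change b.repr (b 1 * b 0) i = _
      rw [hb, mul_one]
      fin_cases i <;> simp
    · change b.repr (b 1 * b 1) i = _
      rw [h, ← hb, map_sub, map_zsmul, map_zsmul, b.repr_self, b.repr_self]
      fin_cases i <;> simp
  have htr : Algebra.trace ℤ (𝓞 K) (b 1) = t := by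
    rw [Algebra.trace_eq_matrix_trace b, hmat]
    simp [Matrix.trace, Fin.sum_univ_two]
  have htr1 : Algebra.trace ℤ (𝓞 K) 1 = 2 := by
    rw [← map_one (algebraMap ℤ (𝓞 K)), Algebra.trace_algebraMap, hfr]; simp
  refine ⟨b 1, t, n, ?_, ?_, ?_⟩
  · rw [← NumberField.discr_eq_discr K b, Algebra.discr_def, Matrix.det_fin_two]
    simp only [Algebra.traceMatrix_apply, Algebra.traceForm_apply, hb, one_mul, mul_one, h, map_sub,
      map_zsmul, htr, htr1]
    simp only [smul_eq_mul]
    ring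
  · rw [RingOfIntegers.exponent_eq_one_iff, eq_top_iff]
    intro z _
    rw [← b.sum_repr z, Fin.sum_univ_two, hb]
    exact add_mem (Subalgebra.smul_mem _ (one_mem _) _)
      (Subalgebra.smul_mem _ (Algebra.self_mem_adjoin_singleton ℤ _) _)
  · symm
    have hdegp : (Polynomial.X ^ 2 - Polynomial.C t * Polynomial.X + Polynomial.C n :
        Polynomial ℤ).natDegree = 2 := by compute_degree!
    have hmon : (Polynomial.X ^ 2 - Polynomial.C t * Polynomial.X + Polynomial.C n :
        Polynomial ℤ).Monic := by monicity!
    have hint : IsIntegral ℤ (b 1) := Algebra.IsIntegral.isIntegral _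
    refine minpoly.IsIntegrallyClosed.unique_of_degree_le_degree_minpoly hmon ?_ ?_
    · simp only [map_add, map_sub, map_mul, map_pow, Polynomial.aeval_X, Polynomial.aeval_C]
      rw [pow_two, h]
      simp
    · rw [Polynomial.degree_eq_natDegree hmon.ne_zero,
        Polynomial.degree_eq_natDegree (minpoly.ne_zero hint), hdegp, Nat.cast_le]
      refine (minpoly.two_le_natDegree_iff hint).2 ?_
      rintro ⟨k, hk⟩
      have h2 := congrArg (fun z => b.repr z 1) hk
      rw [eq_intCast, ← mul_one (k : 𝓞 K), ← zsmul_eq_mul, ← hb] at h2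
      simp only [map_zsmul, b.repr_self] at h2
      simp at h2

theorem zmod_two_quadratic :
    (∀ m : ZMod 2, ∃ a : ZMod 2, a ^ 2 - 0 * a + m = 0 ∧ a = 0 - a) ∧
      (∃ a : ZMod 2, a ^ 2 - 1 * a + 0 = 0 ∧ a ≠ 1 - a) ∧
      ∀ a : ZMod 2, a ^ 2 - 1 * a + 1 ≠ 0 := by decide

/-- The value of the Kronecker symbol of `t ^ 2 - 4 n` at `p` describes the roots of
`X ^ 2 - t X + n` modulo `p`. -/
theorem kroneckerAtPrime_cases {p : ℕ} [hp : Fact p.Prime] (t n : ℤ) :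
    kroneckerAtPrime (t ^ 2 - 4 * n) p = 1 ∧
        (∃ a : ZMod p, a ^ 2 - t * a + n = 0 ∧ a ≠ t - a) ∨
      kroneckerAtPrime (t ^ 2 - 4 * n) p = 0 ∧
        (∃ a : ZMod p, a ^ 2 - t * a + n = 0 ∧ a = t - a) ∨
      kroneckerAtPrime (t ^ 2 - 4 * n) p = -1 ∧ ∀ a : ZMod p, a ^ 2 - t * a + n ≠ 0 := by
  have odd_case : ¬ (t ^ 2 - 4 * n) % 2 = 0 → (t : ZMod 2) = 1 ∧ t ^ 2 % 8 = 1 := by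
    intro h
    have ht : Odd t := by
      have : Odd (t ^ 2) := by rw [Int.odd_iff]; omega
      exact (Int.odd_pow.1 this).resolve_right (by norm_num)
    obtain ⟨k, rfl⟩ := ht
    constructor
    · push_cast
      rw [show (2 : ZMod 2) = 0 from rfl]; ring
    · obtain ⟨m, hm⟩ := (Int.even_mul_succ_self k).two_dvd
      rw [show (2 * k + 1) ^ 2 = 8 * m + 1 by linear_combination 4 * hm]
      omega
  unfold kroneckerAtPrime
  split_ifs with h2 h3 h4
  · subst h2
    right; left
    refine ⟨rfl, ?_⟩
    have ht : (t : ZMod 2) = 0 := by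
      have : Even (t ^ 2) := by rw [Int.even_iff]; omega
      exact (ZMod.intCast_zmod_eq_zero_iff_dvd t 2).2 (Int.even_pow.1 this).1.two_dvd
    rw [ht]
    exact zmod_two_quadratic.1 _
  · subst h2
    left
    refine ⟨rfl, ?_⟩
    obtain ⟨ht1, h8⟩ := odd_case h3
    have hn : (n : ZMod 2) = 0 := (ZMod.intCast_zmod_eq_zero_iff_dvd n 2).2 (by push_cast; omega)
    rw [ht1, hn]
    exact zmod_two_quadratic.2.1
  · subst h2
    right; right
    refine ⟨rfl, ?_⟩
    obtain ⟨ht1, h8⟩ := odd_case h3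
    have hn : (n : ZMod 2) = 1 := by
      have : ((n - 1 : ℤ) : ZMod 2) = 0 :=
        (ZMod.intCast_zmod_eq_zero_iff_dvd _ 2).2 (by push_cast; omega)
      push_cast at this
      linear_combination this
    rw [ht1, hn]
    exact zmod_two_quadratic.2.2
  · rw [← jacobiSym.legendreSym.to_jacobiSym]
    have two_ne : (2 : ZMod p) ≠ 0 := by
      intro h
      have h' : ((2 : ℕ) : ZMod p) = 0 := by exact_mod_cast h
      rw [ZMod.natCast_eq_zero_iff] at h'
      exact h2 ((Nat.prime_dvd_prime_iff_eq hp.out Nat.prime_two).1 h')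
    have cast : ((t ^ 2 - 4 * n : ℤ) : ZMod p) = t ^ 2 - 4 * n := by push_cast; ring
    by_cases h0 : ((t ^ 2 - 4 * n : ℤ) : ZMod p) = 0
    · right; left
      refine ⟨(legendreSym.eq_zero_iff p _).2 h0, t / 2, ?_, ?_⟩
      · rw [cast] at h0
        field_simp
        linear_combination -h0
      · field_simp; ring
    rcases legendreSym.eq_one_or_neg_one p h0 with h | h
    · left
      refine ⟨h, ?_⟩
      obtain ⟨s, hs⟩ := (legendreSym.eq_one_iff p h0).1 h
      refine ⟨(t + s) / 2, ?_, ?_⟩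
      · rw [cast] at hs
        field_simp
        linear_combination -hs
      · intro h
        field_simp at h
        have : (2 * s : ZMod p) = 0 := by linear_combination h
        rcases mul_eq_zero.1 this with h | h
        · exact two_ne h
        · rw [h, mul_zero] at hs; exact h0 hs
    · right; right
      refine ⟨h, fun a ha => (legendreSym.eq_neg_one_iff p).1 h ⟨2 * a - t, ?_⟩⟩
      rw [cast]
      linear_combination -4 * ha

open Polynomial UniqueFactorizationMonoid in
/-- The norms of the primes of a quadratic field above a rational prime `p`. -/
theorem hasSum_primesOver (hdeg : Module.finrank ℚ K = 2) (p : ℕ) [hp : Fact p.Prime]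
    (F : ℕ → ℝ) :
    HasSum (fun P : Ideal.primesOver (Ideal.span {(p : ℤ)}) (𝓞 K) => F (Ideal.absNorm P.1))
      (if kroneckerAtPrime (discr K) p = 1 then F p + F p
        else if kroneckerAtPrime (discr K) p = 0 then F p else F (p ^ 2)) := by
  obtain ⟨θ, t, n, hd, hexp, hmin⟩ := exists_monogenic hdeg
  have hpe : ¬ p ∣ RingOfIntegers.exponent θ := by
    rw [hexp]; exact hp.out.one_lt.ne' ∘ Nat.dvd_one.1
  let e := NumberField.Ideal.primesOverSpanEquivMonicFactorsMod hpe
  have hnorm : ∀ Q, F (Ideal.absNorm (e.symm Q).1) = F (p ^ Q.1.natDegree) := by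
    intro Q
    have h1 := NumberField.Ideal.inertiaDeg_primesOverSpanEquivMonicFactorsMod_symm_apply' hpe Q.2
    have : ((e.symm Q).1).IsPrime := (e.symm Q).2.1
    have : ((e.symm Q).1).LiesOver (Ideal.span {(p : ℤ)}) := (e.symm Q).2.2
    rw [← h1, Ideal.pow_inertiaDeg]
  rw [← e.symm.hasSum_iff]
  have hcomp : (fun P : Ideal.primesOver (Ideal.span {(p : ℤ)}) (𝓞 K) =>
      F (Ideal.absNorm P.1)) ∘ e.symm = (fun Q : (ZMod p)[X] => F (p ^ Q.natDegree)) ∘ (↑) :=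
    funext hnorm
  rw [hcomp]
  have hF := Finset.hasSum (RingOfIntegers.monicFactorsMod θ p)
    (fun Q : (ZMod p)[X] => F (p ^ Q.natDegree))
  suffices h : ∑ Q ∈ RingOfIntegers.monicFactorsMod θ p, F (p ^ Q.natDegree) =
      if kroneckerAtPrime (discr K) p = 1 then F p + F p
        else if kroneckerAtPrime (discr K) p = 0 then F p else F (p ^ 2) by
    rw [← h]; exact hF
  have hmap : (minpoly ℤ θ).map (Int.castRingHom (ZMod p)) =
      X ^ 2 - C (t : ZMod p) * X + C (n : ZMod p) := by
    rw [hmin]; simp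
  have hsplit : ∀ a : ZMod p, a ^ 2 - t * a + n = 0 →
      normalizedFactors ((minpoly ℤ θ).map (Int.castRingHom (ZMod p))) =
        {X - C a, X - C (t - a)} := by
    intro a ha
    have : (X ^ 2 - C (t : ZMod p) * X + C (n : ZMod p) : (ZMod p)[X]) =
        (X - C a) * (X - C (t - a)) := by
      have hn : (n : ZMod p) = a * (t - a) := by linear_combination ha
      rw [hn]
      simp only [map_mul, map_sub]
      ring
    rw [hmap, this, normalizedFactors_mul (X_sub_C_ne_zero _) (X_sub_C_ne_zero _),
      normalizedFactors_irreducible (irreducible_X_sub_C _),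
      normalizedFactors_irreducible (irreducible_X_sub_C _),
      (monic_X_sub_C _).normalize_eq_self, (monic_X_sub_C _).normalize_eq_self]
    rfl
  rw [hd]
  rcases kroneckerAtPrime_cases (p := p) t n with ⟨h, a, ha, hne⟩ | ⟨h, a, ha, heq⟩ | ⟨h, hno⟩
  · rw [if_pos h, RingOfIntegers.monicFactorsMod, hsplit a ha]
    have : (X - C a : (ZMod p)[X]) ≠ X - C (t - a) := fun h => hne <| by
      have := congrArg (eval a) h
      simp only [eval_sub, eval_X, eval_C, sub_self] at this
      exact (sub_eq_zero.1 this.symm)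
    have hset : ({X - C a, X - C (t - a)} : Multiset (ZMod p)[X]).toFinset =
        {X - C a, X - C (t - a)} := by ext; simp
    rw [hset, Finset.sum_pair this, natDegree_X_sub_C, natDegree_X_sub_C, pow_one]
  · rw [if_neg (by rw [h]; decide), if_pos h, RingOfIntegers.monicFactorsMod, hsplit a ha,
      ← heq]
    simp
  · rw [if_neg (by rw [h]; decide), if_neg (by rw [h]; decide),
      RingOfIntegers.monicFactorsMod, hmap]
    have hdegp : (X ^ 2 - C (t : ZMod p) * X + C (n : ZMod p)).natDegree = 2 := by
      compute_degree!
    have hmon : (X ^ 2 - C (t : ZMod p) * X + C (n : ZMod p)).Monic := by monicity!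
    have hirr : Irreducible (X ^ 2 - C (t : ZMod p) * X + C (n : ZMod p)) := by
      refine (irreducible_iff_roots_eq_zero_of_degree_le_three (by rw [hdegp])
        (by rw [hdegp]; norm_num)).2 ?_
      rw [Multiset.eq_zero_iff_forall_notMem]
      intro a ha
      have := (mem_roots'.1 ha).2
      exact hno a (by simpa using this)
    rw [normalizedFactors_irreducible hirr, hmon.normalize_eq_self]
    rw [Multiset.toFinset_singleton, Finset.sum_singleton, hdegp]

end QuadraticOrder

section EulerLog

theorem summable_neg_log_one_sub {ι : Type*} {f : ι → ℝ} (hf : Summable f) :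
    Summable fun i => -Real.log (1 - f i) := by
  have := (Real.summable_log_one_add_of_summable hf.neg).neg
  simpa [sub_eq_add_neg] using this

/-- The logarithmic form of the Euler product of a completely multiplicative function. -/
theorem exp_tsum_neg_log_one_sub {f : ℕ →*₀ ℝ} (hf : Summable fun n => ‖f n‖)
    (h1 : ∀ p : Nat.Primes, f p < 1) :
    Real.exp (∑' p : Nat.Primes, -Real.log (1 - f p)) = ∑' n, f n := by
  have hs : Summable fun p : Nat.Primes => f p :=
    hf.of_norm.comp_injective Nat.Primes.coe_nat_injective
  have hsum := summable_neg_log_one_sub hs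
  simp only [← Real.log_inv] at hsum ⊢
  exact (Real.hasProd_of_hasSum_log (fun p => inv_pos.2 (sub_pos.2 (h1 p))) hsum.hasSum).unique
    (EulerProduct.eulerProduct_completely_multiplicative_hasProd hf)

theorem kroneckerAtPrime_abs_le (Δ : ℤ) (p : ℕ) : |kroneckerAtPrime Δ p| ≤ 1 := by
  unfold kroneckerAtPrime
  split_ifs
  · simp
  · simp
  · simp
  · rcases jacobiSym.trichotomy Δ p with h | h | h <;> rw [h] <;> simp

theorem kroneckerChar_prime (Δ : ℤ) {p : ℕ} (hp : p.Prime) :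
    kroneckerChar Δ p = kroneckerAtPrime Δ p := by
  rw [kroneckerChar, hp.factorization, Finsupp.prod_single_index (by simp), pow_one]

theorem kroneckerChar_one (Δ : ℤ) : kroneckerChar Δ 1 = 1 := by
  simp [kroneckerChar]

theorem kroneckerChar_mul (Δ : ℤ) {m n : ℕ} (hm : m ≠ 0) (hn : n ≠ 0) :
    kroneckerChar Δ (m * n) = kroneckerChar Δ m * kroneckerChar Δ n := by
  rw [kroneckerChar, Nat.factorization_mul hm hn, Finsupp.prod_add_index']
  · rfl
  · simp
  · intro a b c; rw [pow_add]

theorem kroneckerChar_abs_le (Δ : ℤ) (n : ℕ) : |kroneckerChar Δ n| ≤ 1 := by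
  rw [kroneckerChar, Finsupp.prod, Finset.abs_prod]
  refine Finset.prod_le_one (fun _ _ => abs_nonneg _) fun p _ => ?_
  rw [abs_pow]
  exact pow_le_one₀ (abs_nonneg _) (kroneckerAtPrime_abs_le Δ p)

/-- The summand `χ(n) n⁻ˢ` as a completely multiplicative function. -/
noncomputable def kroneckerSummand (Δ : ℤ) (s : ℝ) (hs : s ≠ 0) : ℕ →*₀ ℝ where
  toFun n := kroneckerChar Δ n * (n : ℝ) ^ (-s)
  map_zero' := by rw [Nat.cast_zero, Real.zero_rpow (neg_ne_zero.2 hs), mul_zero]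
  map_one' := by rw [kroneckerChar_one]; simp
  map_mul' m n := by
    rcases eq_or_ne m 0 with rfl | hm
    · rw [zero_mul, Nat.cast_zero, Real.zero_rpow (neg_ne_zero.2 hs)]; simp
    rcases eq_or_ne n 0 with rfl | hn
    · rw [mul_zero, Nat.cast_zero, Real.zero_rpow (neg_ne_zero.2 hs)]; simp
    rw [kroneckerChar_mul Δ hm hn, Nat.cast_mul, Real.mul_rpow (by positivity) (by positivity)]
    push_cast
    ring

/-- The summand `n⁻ˢ` as a completely multiplicative function. -/
noncomputable def zetaSummand (s : ℝ) (hs : s ≠ 0) : ℕ →*₀ ℝ where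
  toFun n := (n : ℝ) ^ (-s)
  map_zero' := by rw [Nat.cast_zero, Real.zero_rpow (neg_ne_zero.2 hs)]
  map_one' := by simp
  map_mul' m n := by rw [Nat.cast_mul, Real.mul_rpow (by positivity) (by positivity)]

theorem summable_kroneckerSummand (Δ : ℤ) {s : ℝ} (hs : 1 < s) :
    Summable fun n => ‖kroneckerSummand Δ s (by positivity) n‖ := by
  refine .of_nonneg_of_le (fun _ => norm_nonneg _) (fun n => ?_)
    (Real.summable_nat_rpow.2 (neg_lt_neg hs))
  change |(kroneckerChar Δ n : ℝ) * (n : ℝ) ^ (-s)| ≤ _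
  have h1 : |(kroneckerChar Δ n : ℝ)| ≤ 1 := by exact_mod_cast kroneckerChar_abs_le Δ n
  have h2 : (0 : ℝ) ≤ (n : ℝ) ^ (-s) := by positivity
  rw [abs_mul, abs_of_nonneg h2]
  exact mul_le_of_le_one_left h2 h1

theorem summable_zetaSummand {s : ℝ} (hs : 1 < s) :
    Summable fun n => ‖zetaSummand s (by positivity) n‖ :=
  (Real.summable_nat_rpow.2 (neg_lt_neg hs)).norm

theorem nat_rpow_neg_lt_one {n : ℕ} (hn : 1 < n) {s : ℝ} (hs : 0 < s) : (n : ℝ) ^ (-s) < 1 :=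
  Real.rpow_lt_one_of_one_lt_of_neg (by exact_mod_cast hn) (neg_lt_zero.2 hs)

end EulerLog

section PrimeZeta

open IsDedekindDomain

variable (K : Type*) [Field K] [NumberField K]

/-- The nonzero primes of `𝓞 K`, sorted by the rational prime below them. -/
theorem primesOver_bijective : Function.Bijective
    (fun x : (Σ p : Nat.Primes, Ideal.primesOver (Ideal.span {((p : ℕ) : ℤ)}) (𝓞 K)) =>
      (⟨x.2.1, x.2.2.1, fun h => by
        have h1 := x.2.2.2.over
        rw [h, Ideal.under_def, Ideal.comap_bot_of_injective _
          (FaithfulSMul.algebraMap_injective ℤ (𝓞 K)), Ideal.span_singleton_eq_bot] at h1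
        exact x.1.2.ne_zero (by exact_mod_cast h1)⟩ : HeightOneSpectrum (𝓞 K))) := by
  constructor
  · rintro ⟨p, P, hP, hp⟩ ⟨q, Q, hQ, hq⟩ h
    have hPQ : P = Q := congrArg HeightOneSpectrum.asIdeal h
    subst hPQ
    have h1 := hp.over.trans hq.over.symm
    rw [Ideal.span_singleton_eq_span_singleton, Int.associated_iff_natAbs] at h1
    have : p = q := Subtype.ext (by simpa using h1)
    subst this
    rfl
  · intro v
    have hb : v.asIdeal.under ℤ ≠ ⊥ := mt Ideal.eq_bot_of_comap_eq_bot v.ne_bot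
    have : (v.asIdeal.under ℤ).IsPrime := inferInstance
    obtain ⟨g, hg⟩ := IsPrincipalIdealRing.principal (v.asIdeal.under ℤ)
    have hg' : v.asIdeal.under ℤ = Ideal.span {g} := hg
    have hg0 : g ≠ 0 := by
      rintro rfl
      exact hb (by rw [hg', Ideal.span_singleton_eq_bot])
    have hgp : Prime g := by
      rw [← Ideal.span_singleton_prime hg0, ← hg']; exact this
    have hsp : Ideal.span {((g.natAbs : ℕ) : ℤ)} = v.asIdeal.under ℤ := by
      rw [hg', Ideal.span_singleton_eq_span_singleton, Int.associated_iff_natAbs, Int.natAbs_natCast]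
    exact ⟨⟨⟨g.natAbs, Int.prime_iff_natAbs_prime.1 hgp⟩, v.asIdeal, v.isPrime, ⟨hsp⟩⟩, rfl⟩

variable {K}

theorem one_lt_absNorm (v : HeightOneSpectrum (𝓞 K)) : 1 < Ideal.absNorm v.asIdeal := by
  have h0 : Ideal.absNorm v.asIdeal ≠ 0 := Ideal.absNorm_eq_zero_iff.not.2 v.ne_bot
  have h1 : Ideal.absNorm v.asIdeal ≠ 1 := Ideal.absNorm_eq_one_iff.not.2 v.isPrime.ne_top
  omega

theorem neg_log_one_sub_nonneg {u : ℝ} (h0 : 0 ≤ u) (h1 : u < 1) : 0 ≤ -Real.log (1 - u) :=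
  neg_nonneg.2 (Real.log_nonpos (by linarith) (by linarith))

/-- The sum of a function of the norm over the primes of a quadratic field. -/
theorem hasSum_heightOneSpectrum (hdeg : Module.finrank ℚ K = 2) {F : ℕ → ℝ} 
    (hF : ∀ n, 1 < n → 0 ≤ F n) {S : ℝ}
    (hS : HasSum (fun p : Nat.Primes => if kroneckerAtPrime (discr K) p = 1 then F p + F p
        else if kroneckerAtPrime (discr K) p = 0 then F p else F (p ^ 2)) S) :
    HasSum (fun v : HeightOneSpectrum (𝓞 K) => F (Ideal.absNorm v.asIdeal)) S := by
  rw [← (Equiv.ofBijective _ (primesOver_bijective K)).hasSum_iff]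
  have hfib (p : Nat.Primes) := by
    have : Fact (p : ℕ).Prime := ⟨p.2⟩
    exact hasSum_primesOver hdeg p F
  have hpos : ∀ x : (Σ p : Nat.Primes, Ideal.primesOver (Ideal.span {((p : ℕ) : ℤ)}) (𝓞 K)),
      0 ≤ F (Ideal.absNorm x.2.1) := fun x =>
    hF _ (one_lt_absNorm (Equiv.ofBijective _ (primesOver_bijective K) x))
  have hsum : Summable fun x : (Σ p : Nat.Primes,
      Ideal.primesOver (Ideal.span {((p : ℕ) : ℤ)}) (𝓞 K)) => F (Ideal.absNorm x.2.1) := by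
    rw [summable_sigma_of_nonneg hpos]
    refine ⟨fun p => (hfib p).summable, ?_⟩
    simp only [(hfib _).tsum_eq]
    exact hS.summable
  have h := hsum.hasSum
  rw [(h.sigma hfib).unique hS] at h
  exact h

theorem natCast_sq_rpow (n : ℕ) (s : ℝ) : ((n ^ 2 : ℕ) : ℝ) ^ s = ((n : ℝ) ^ s) ^ 2 := by
  rw [Nat.cast_pow, ← Real.rpow_natCast, ← Real.rpow_natCast, ← Real.rpow_mul (by positivity),
    ← Real.rpow_mul (by positivity), mul_comm]

/-- The logarithmic Euler product of the Dedekind zeta function of a quadratic field factors as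
the Riemann zeta function times the Dirichlet series of the Kronecker symbol. -/
theorem exp_tsum_primes (hdeg : Module.finrank ℚ K = 2) {s : ℝ} (hs : 1 < s) :
    (Summable fun v : HeightOneSpectrum (𝓞 K) =>
      -Real.log (1 - (Ideal.absNorm v.asIdeal : ℝ) ^ (-s))) ∧
    Real.exp (∑' v : HeightOneSpectrum (𝓞 K),
      -Real.log (1 - (Ideal.absNorm v.asIdeal : ℝ) ^ (-s))) =
      (∑' n : ℕ, (n : ℝ) ^ (-s)) * ∑' n : ℕ, (kroneckerChar (discr K) n : ℝ) * (n : ℝ) ^ (-s) := by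
  have hs0 : s ≠ 0 := by positivity
  have hz := summable_zetaSummand hs
  have hk := summable_kroneckerSummand (discr K) hs
  have hlt : ∀ p : Nat.Primes, (p : ℝ) ^ (-s) < 1 := fun p =>
    nat_rpow_neg_lt_one p.2.one_lt (by positivity)
  have hpos : ∀ p : Nat.Primes, 0 < ((p : ℕ) : ℝ) ^ (-s) := fun p =>
    Real.rpow_pos_of_pos (by exact_mod_cast p.2.pos) _
  have hkp : ∀ p : Nat.Primes, kroneckerSummand (discr K) s hs0 p =
      kroneckerAtPrime (discr K) p * ((p : ℕ) : ℝ) ^ (-s) := fun p => by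
    change (kroneckerChar (discr K) p : ℝ) * _ = _
    rw [kroneckerChar_prime _ p.2]
  have hk1 : ∀ p : Nat.Primes, kroneckerSummand (discr K) s hs0 p < 1 := fun p => by
    rw [hkp]
    have h1 : (kroneckerAtPrime (discr K) p : ℝ) ≤ 1 := by
      exact_mod_cast (abs_le.1 (kroneckerAtPrime_abs_le (discr K) p)).2
    nlinarith [hlt p, hpos p]
  have ez := exp_tsum_neg_log_one_sub hz (fun p => hlt p)
  have ek := exp_tsum_neg_log_one_sub hk hk1
  have sz := summable_neg_log_one_sub (hz.of_norm.comp_injective Nat.Primes.coe_nat_injective)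
  have sk := summable_neg_log_one_sub (hk.of_norm.comp_injective Nat.Primes.coe_nat_injective)
  have hsum := hasSum_heightOneSpectrum hdeg
    (F := fun n => -Real.log (1 - (n : ℝ) ^ (-s)))
    (fun n hn => neg_log_one_sub_nonneg (by positivity) (nat_rpow_neg_lt_one hn (by positivity)))
    (S := _) (by
      refine (sz.hasSum.add sk.hasSum).congr_fun fun p => ?_
      change _ = -Real.log (1 - ((p : ℕ) : ℝ) ^ (-s)) +
        -Real.log (1 - kroneckerSummand (discr K) s hs0 p)
      rw [hkp p]
      have : Fact (p : ℕ).Prime := ⟨p.2⟩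
      obtain ⟨θ, t, n, hd, -, -⟩ := exists_monogenic hdeg
      have h3 := kroneckerAtPrime_cases (p := p) t n
      rw [← hd] at h3
      rcases h3 with ⟨h, -⟩ | ⟨h, -⟩ | ⟨h, -⟩
      · simp [h]
      · simp [h]
      · rw [h, if_neg (by decide), if_neg (by decide), natCast_sq_rpow]
        have h1 := hlt p
        have h2 := hpos p
        generalize ((p : ℕ) : ℝ) ^ (-s) = u at h1 h2 ⊢
        rw [← neg_add, ← Real.log_mul (by linarith) (by push_cast; linarith)]
        push_cast
        ring_nf)
  refine ⟨hsum.summable, ?_⟩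
  rw [hsum.tsum_eq, Real.exp_add]
  exact congrArg₂ _ ez ek

end PrimeZeta

section AbelSummation

theorem tendsto_one_add_nhdsGT : Tendsto (fun δ : ℝ => 1 + δ) (𝓝[>] 0) (𝓝[>] 1) := by
  refine tendsto_nhdsWithin_iff.2 ⟨?_, ?_⟩
  · have : Tendsto (fun δ : ℝ => 1 + δ) (𝓝 0) (𝓝 (1 + 0)) :=
      (continuous_const.add continuous_id).tendsto 0
    rw [add_zero] at this
    exact this.mono_left nhdsWithin_le_nhds
  · filter_upwards [self_mem_nhdsWithin] with δ hδ
    simpa using hδ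

theorem sum_mul_by_parts (B w : ℕ → ℝ) (N : ℕ) :
    ∑ n ∈ Finset.range N, (B (n + 1) - B n) * w n =
      B N * w N - B 0 * w 0 + ∑ n ∈ Finset.range N, B (n + 1) * (w n - w (n + 1)) := by
  induction N with
  | zero => simp
  | succ N ih => rw [Finset.sum_range_succ, ih, Finset.sum_range_succ]; ring

/-- An Abelian theorem: inserting monotone weights that tend to `1` does not change the value of a
convergent series in the limit. -/
theorem tendsto_of_antitone_weights {a : ℕ → ℝ} {L : ℝ}
    (ha : Tendsto (fun N => ∑ n ∈ Finset.range N, a n) atTop (𝓝 L))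
    {l : Filter ℝ} {w : ℝ → ℕ → ℝ} {T : ℝ → ℝ}
    (hanti : ∀ᶠ δ in l, Antitone (w δ)) (hnonneg : ∀ᶠ δ in l, ∀ n, 0 ≤ w δ n)
    (hzero : ∀ᶠ δ in l, w δ 0 = 1) (hone : ∀ n, Tendsto (fun δ => w δ n) l (𝓝 1))
    (hT : ∀ᶠ δ in l, Tendsto (fun N => ∑ n ∈ Finset.range N, a n * w δ n) atTop (𝓝 (T δ))) :
    Tendsto T l (𝓝 L) := by
  set B : ℕ → ℝ := fun N => ∑ n ∈ Finset.range N, a n - L with hB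
  have hB0 : Tendsto B atTop (𝓝 0) := by simpa using ha.sub_const L
  obtain ⟨C, hC⟩ : ∃ C, ∀ n, |B n| ≤ C := by
    obtain ⟨C, hC⟩ := hB0.norm.bddAbove_range
    exact ⟨C, fun n => hC ⟨n, rfl⟩⟩
  have hC0 : 0 ≤ C := (abs_nonneg _).trans (hC 0)
  rw [Metric.tendsto_nhds]
  intro ε hε
  obtain ⟨M, hM⟩ : ∃ M, ∀ n ≥ M, |B n| < ε / 4 := by
    obtain ⟨M, hM⟩ := Metric.tendsto_atTop.1 hB0 (ε / 4) (by positivity)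
    exact ⟨M, fun n hn => by simpa using hM n hn⟩
  have hw : ∀ᶠ δ in l, C * (1 - w δ M) < ε / 4 := by
    have : Tendsto (fun δ => C * (1 - w δ M)) l (𝓝 (C * (1 - 1))) :=
      (tendsto_const_nhds.sub (hone M)).const_mul C
    rw [sub_self, mul_zero] at this
    exact this.eventually_lt_const (by positivity)
  filter_upwards [hanti, hnonneg, hzero, hT, hw] with δ h1 h2 h3 h4 h5
  have hle1 : ∀ n, w δ n ≤ 1 := fun n => h3 ▸ h1 (Nat.zero_le n)
  have key : ∀ N ≥ M, |∑ n ∈ Finset.range N, a n * w δ n - L| ≤ 3 * (ε / 4) := by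
    intro N hN
    have e1 : ∑ n ∈ Finset.range N, a n * w δ n =
        ∑ n ∈ Finset.range N, (B (n + 1) - B n) * w δ n := by
      refine Finset.sum_congr rfl fun n _ => ?_
      rw [hB]
      simp only [Finset.sum_range_succ]
      ring
    have e2 : ∑ n ∈ Finset.range N, a n * w δ n - L =
        B N * w δ N + ∑ n ∈ Finset.range N, B (n + 1) * (w δ n - w δ (n + 1)) := by
      rw [e1, sum_mul_by_parts, h3]
      simp only [hB, Finset.range_zero, Finset.sum_empty]
      ring
    have hd : ∀ n, 0 ≤ w δ n - w δ (n + 1) := fun n => sub_nonneg.2 (h1 (Nat.le_succ n))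
    have b1 : |B N * w δ N| ≤ ε / 4 := by
      rw [abs_mul, abs_of_nonneg (h2 N)]
      exact (mul_le_of_le_one_right (abs_nonneg _) (hle1 N)).trans (hM N hN).le
    have b2 : |∑ n ∈ Finset.range N, B (n + 1) * (w δ n - w δ (n + 1))| ≤
        C * (1 - w δ M) + ε / 4 := by
      refine (Finset.abs_sum_le_sum_abs _ _).trans ?_
      rw [← Finset.sum_range_add_sum_Ico _ hN]
      refine add_le_add ?_ ?_
      · calc ∑ n ∈ Finset.range M, |B (n + 1) * (w δ n - w δ (n + 1))|
            ≤ ∑ n ∈ Finset.range M, C * (w δ n - w δ (n + 1)) := by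
              refine Finset.sum_le_sum fun n _ => ?_
              rw [abs_mul, abs_of_nonneg (hd n)]
              exact mul_le_mul_of_nonneg_right (hC _) (hd n)
          _ = C * (1 - w δ M) := by
              rw [← Finset.mul_sum, Finset.sum_range_sub', h3]
      · calc ∑ n ∈ Finset.Ico M N, |B (n + 1) * (w δ n - w δ (n + 1))|
            ≤ ∑ n ∈ Finset.Ico M N, ε / 4 * (w δ n - w δ (n + 1)) := by
              refine Finset.sum_le_sum fun n hn => ?_
              rw [abs_mul, abs_of_nonneg (hd n)]
              exact mul_le_mul_of_nonneg_right
                (hM _ ((Finset.mem_Ico.1 hn).1.trans (Nat.le_succ n))).le (hd n)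
          _ = ε / 4 * (w δ M - w δ N) := by
              rw [← Finset.mul_sum, ← neg_sub (w δ N), ← Finset.sum_Ico_sub _ hN,
                ← Finset.sum_neg_distrib]
              simp
          _ ≤ ε / 4 := by
              refine mul_le_of_le_one_right (by positivity) ?_
              linarith [hle1 M, h2 N]
    rw [e2]
    exact (abs_add_le _ _).trans (by linarith)
  have := le_of_tendsto ((h4.sub_const L).abs) (eventually_atTop.2 ⟨M, key⟩)
  rw [Real.dist_eq]
  linarith

/-- The Dirichlet series of the Kronecker symbol is right-continuous at `1`. -/
theorem tendsto_tsum_kroneckerChar {Δ : ℤ} {L : ℝ}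
    (hL : Tendsto (fun N : ℕ => ∑ n ∈ Finset.range N, (kroneckerChar Δ n : ℝ) / n) atTop (𝓝 L)) :
    Tendsto (fun δ : ℝ => ∑' n : ℕ, (kroneckerChar Δ n : ℝ) * (n : ℝ) ^ (-(1 + δ)))
      (𝓝[>] 0) (𝓝 L) := by
  have ha : Tendsto (fun N : ℕ => ∑ n ∈ Finset.range N,
      (kroneckerChar Δ (n + 1) : ℝ) / ((n + 1 : ℕ) : ℝ)) atTop (𝓝 L) := by
    refine (hL.comp (tendsto_add_atTop_nat 1)).congr fun N => ?_
    simp [Finset.sum_range_succ']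
  refine tendsto_of_antitone_weights (w := fun δ n => ((n + 1 : ℕ) : ℝ) ^ (-δ)) ha ?_ ?_ ?_ ?_ ?_
  · filter_upwards [self_mem_nhdsWithin] with δ hδ
    intro m n hmn
    exact Real.rpow_le_rpow_of_nonpos (by positivity) (by exact_mod_cast Nat.succ_le_succ hmn)
      (neg_nonpos.2 (le_of_lt hδ))
  · exact Eventually.of_forall fun δ n => by positivity
  · exact Eventually.of_forall fun δ => by simp
  · intro n
    have : Tendsto (fun δ : ℝ => ((n + 1 : ℕ) : ℝ) ^ (-δ)) (𝓝 0)
        (𝓝 (((n + 1 : ℕ) : ℝ) ^ (-0 : ℝ))) :=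
      ((Real.continuous_const_rpow (by positivity)).comp continuous_neg).tendsto 0
    rw [neg_zero, Real.rpow_zero] at this
    exact this.mono_left nhdsWithin_le_nhds
  · filter_upwards [self_mem_nhdsWithin] with δ hδ
    have hδ' : (1 : ℝ) < 1 + δ := by simpa using hδ
    have h := (summable_kroneckerSummand Δ hδ').of_norm.hasSum.tendsto_sum_nat.comp
      (tendsto_add_atTop_nat 1)
    refine h.congr fun N => ?_
    simp only [Function.comp_apply]
    rw [Finset.sum_range_succ', map_zero, add_zero]
    refine Finset.sum_congr rfl fun n _ => ?_
    change (kroneckerChar Δ (n + 1) : ℝ) * _ = _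
    rw [neg_add, Real.rpow_add (by positivity), Real.rpow_neg_one]
    ring

end AbelSummation

section PrimeZetaLimit

open IsDedekindDomain

variable {K : Type*} [Field K] [NumberField K]

theorem tendsto_mul_exp_tsum_primes (hdeg : Module.finrank ℚ K = 2) {L : ℝ}
    (hL : Tendsto (fun N : ℕ => ∑ n ∈ Finset.range N, (kroneckerChar (discr K) n : ℝ) / n)
      atTop (𝓝 L)) :
    Tendsto (fun δ : ℝ => δ * Real.exp (∑' v : HeightOneSpectrum (𝓞 K),
      -Real.log (1 - (Ideal.absNorm v.asIdeal : ℝ) ^ (-(1 + δ))))) (𝓝[>] 0) (𝓝 L) := by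
  have h := (tendsto_sub_mul_tsum_nat_rpow.comp tendsto_one_add_nhdsGT).mul
    (tendsto_tsum_kroneckerChar hL)
  rw [one_mul] at h
  refine h.congr' ?_
  filter_upwards [self_mem_nhdsWithin] with δ hδ
  have hδ' : (1 : ℝ) < 1 + δ := by simpa using hδ
  rw [(exp_tsum_primes hdeg hδ').2]
  simp only [Function.comp_apply, add_sub_cancel_left, one_div, ← Real.rpow_neg (Nat.cast_nonneg _)]
  ring

end PrimeZetaLimit

section DedekindZetaBound

open IsDedekindDomain

variable {K : Type*} [Field K] [NumberField K]

/-- The exponent of the prime `v` in the ideal `I`. -/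
noncomputable def primeExponent (v : HeightOneSpectrum (𝓞 K)) (I : Ideal (𝓞 K)) : ℕ :=
  open Classical in (Associates.mk v.asIdeal).count (Associates.mk I).factors

theorem exists_finset_prod_eq {I : Ideal (𝓞 K)} (hI : I ≠ ⊥) :
    ∃ S : Finset (HeightOneSpectrum (𝓞 K)), ∀ S', S ⊆ S' →
      ∏ v ∈ S', v.asIdeal ^ primeExponent v I = I := by
  have hfin := Ideal.hasFiniteMulSupport (R := 𝓞 K) hI
  refine ⟨hfin.toFinset, fun S' hS' => ?_⟩
  rw [← finprod_eq_prod_of_mulSupport_subset (s := S')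
    (fun v : HeightOneSpectrum (𝓞 K) => v.asIdeal ^ primeExponent v I)]
  · exact Ideal.finprod_heightOneSpectrum_factorization hI
  · intro v hv
    exact hS' (hfin.mem_toFinset.2 hv)

theorem sum_absNorm_rpow_le {s : ℝ} (hs : 0 < s)
    (hsum : Summable fun v : HeightOneSpectrum (𝓞 K) =>
      -Real.log (1 - (Ideal.absNorm v.asIdeal : ℝ) ^ (-s)))
    (T : Finset (Ideal (𝓞 K))) (hT : ∀ I ∈ T, I ≠ ⊥) :
    ∑ I ∈ T, (Ideal.absNorm I : ℝ) ^ (-s) ≤ Real.exp (∑' v : HeightOneSpectrum (𝓞 K),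
      -Real.log (1 - (Ideal.absNorm v.asIdeal : ℝ) ^ (-s))) := by
  classical
  choose! S₀ hS₀ using fun (I : Ideal (𝓞 K)) (hI : I ≠ ⊥) => exists_finset_prod_eq hI
  set S := T.biUnion S₀ with hS
  have hprod : ∀ I ∈ T, ∏ v ∈ S, v.asIdeal ^ primeExponent v I = I := fun I hI =>
    hS₀ I (hT I hI) S (Finset.subset_biUnion_of_mem S₀ hI)
  set x : HeightOneSpectrum (𝓞 K) → ℝ := fun v => (Ideal.absNorm v.asIdeal : ℝ) ^ (-s) with hx
  have hx0 : ∀ v, 0 ≤ x v := fun v => by positivity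
  have hx1 : ∀ v, x v < 1 := fun v => nat_rpow_neg_lt_one (one_lt_absNorm v) hs
  have hnorm : ∀ I ∈ T, (Ideal.absNorm I : ℝ) ^ (-s) = ∏ v : S, x v ^ primeExponent v.1 I := by
    intro I hI
    conv_lhs => rw [← hprod I hI]
    rw [map_prod, Nat.cast_prod, ← Real.finsetProd_rpow _ _ (fun _ _ => Nat.cast_nonneg _),
      ← Finset.prod_coe_sort]
    refine Finset.prod_congr rfl fun v _ => ?_
    rw [map_pow, Nat.cast_pow, hx, ← Real.rpow_natCast, ← Real.rpow_natCast,
      ← Real.rpow_mul (Nat.cast_nonneg _), ← Real.rpow_mul (Nat.cast_nonneg _), mul_comm]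
  obtain ⟨M, hM⟩ : ∃ M, ∀ I ∈ T, ∀ v ∈ S, primeExponent v I < M := by
    refine ⟨(T ×ˢ S).sup (fun q => primeExponent q.2 q.1) + 1, fun I hI v hv => ?_⟩
    exact Nat.lt_succ_of_le (Finset.le_sup (f := fun q : Ideal (𝓞 K) × HeightOneSpectrum (𝓞 K) =>
      primeExponent q.2 q.1) (Finset.mem_product.2 ⟨hI, hv⟩ : (I, v) ∈ T ×ˢ S))
  set e : Ideal (𝓞 K) → S → ℕ := fun I v => primeExponent v.1 I with he
  have hinj : Set.InjOn e T := by
    intro I hI J hJ hIJ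
    rw [← hprod I hI, ← hprod J hJ]
    refine Finset.prod_congr rfl fun v hv => ?_
    rw [show primeExponent v I = primeExponent v J from congrFun hIJ ⟨v, hv⟩]
  calc ∑ I ∈ T, (Ideal.absNorm I : ℝ) ^ (-s)
      = ∑ I ∈ T, ∏ v : S, x v ^ e I v := Finset.sum_congr rfl hnorm
    _ = ∑ k ∈ T.image e, ∏ v : S, x v ^ k v :=
        (Finset.sum_image (f := fun k : S → ℕ => ∏ v : S, x v ^ k v) hinj).symm
    _ ≤ ∑ k ∈ Fintype.piFinset fun _ : S => Finset.range M, ∏ v : S, x v ^ k v := by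
        refine Finset.sum_le_sum_of_subset_of_nonneg ?_
          fun k _ _ => Finset.prod_nonneg fun v _ => pow_nonneg (hx0 v) _
        intro k hk
        obtain ⟨I, hI, rfl⟩ := Finset.mem_image.1 hk
        exact Fintype.mem_piFinset.2 fun v => Finset.mem_range.2 (hM I hI v.1 v.2)
    _ = ∏ v : S, ∑ k ∈ Finset.range M, x v ^ k := (Finset.prod_univ_sum _ _).symm
    _ ≤ ∏ v : S, (1 - x v)⁻¹ := by
        refine Finset.prod_le_prod
          (fun v _ => Finset.sum_nonneg fun k _ => pow_nonneg (hx0 v) _) fun v _ => ?_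
        rw [← tsum_geometric_of_lt_one (hx0 v) (hx1 v)]
        exact (summable_geometric_of_lt_one (hx0 v) (hx1 v)).sum_le_tsum _
          fun k _ => pow_nonneg (hx0 v) _
    _ = Real.exp (∑ v ∈ S, -Real.log (1 - x v)) := by
        rw [Real.exp_sum, ← Finset.prod_coe_sort S]
        refine Finset.prod_congr rfl fun v _ => ?_
        rw [← Real.log_inv, Real.exp_log (inv_pos.2 (sub_pos.2 (hx1 v)))]
    _ ≤ _ := Real.exp_le_exp.2 (hsum.sum_le_tsum _ fun v _ =>
        neg_log_one_sub_nonneg (hx0 v) (hx1 v))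

theorem sum_range_card_rpow_le {s : ℝ} (hs : 0 < s)
    (hsum : Summable fun v : HeightOneSpectrum (𝓞 K) =>
      -Real.log (1 - (Ideal.absNorm v.asIdeal : ℝ) ^ (-s))) (N : ℕ) :
    ∑ n ∈ Finset.range N, (Nat.card {I : Ideal (𝓞 K) // Ideal.absNorm I = n} : ℝ) * (n : ℝ) ^ (-s) ≤
      Real.exp (∑' v : HeightOneSpectrum (𝓞 K),
        -Real.log (1 - (Ideal.absNorm v.asIdeal : ℝ) ^ (-s))) := by
  classical
  have hfin := Ideal.finite_setOfPred_absNorm_le (S := 𝓞 K) N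
  set T := hfin.toFinset.filter (fun I => I ≠ ⊥ ∧ Ideal.absNorm I < N) with hT
  refine le_trans (le_of_eq ?_) (sum_absNorm_rpow_le hs hsum T fun I hI =>
    (Finset.mem_filter.1 hI).2.1)
  rw [← Finset.sum_fiberwise_of_maps_to (s := T) (t := Finset.range N) (g := Ideal.absNorm)
    (fun I hI => Finset.mem_range.2 (Finset.mem_filter.1 hI).2.2)]
  refine Finset.sum_congr rfl fun n hn => ?_
  rcases eq_or_ne n 0 with rfl | hn0
  · rw [Nat.cast_zero, Real.zero_rpow (by linarith), mul_zero]
    refine (Finset.sum_eq_zero fun I hI => ?_).symm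
    rw [(Finset.mem_filter.1 hI).2, Nat.cast_zero, Real.zero_rpow (by linarith)]
  · rw [Finset.sum_congr rfl (fun I hI => by rw [(Finset.mem_filter.1 hI).2] :
      ∀ I ∈ T.filter (fun I => Ideal.absNorm I = n),
        (Ideal.absNorm I : ℝ) ^ (-s) = (n : ℝ) ^ (-s)), Finset.sum_const, nsmul_eq_mul]
    congr 2
    refine Nat.subtype_card _ fun I => ?_
    simp only [hT, Finset.mem_filter, Set.Finite.mem_toFinset, Set.mem_ofPred_eq]
    refine ⟨fun h => h.2, fun h => ⟨⟨?_, ?_, ?_⟩, h⟩⟩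
    · exact h.le.trans (Finset.mem_range.1 hn).le
    · rintro rfl
      exact hn0 (by simpa using h.symm)
    · exact h.trans_lt (Finset.mem_range.1 hn)

/-- The value `L(1, χ)` is positive. -/
theorem kroneckerChar_series_pos (hdeg : Module.finrank ℚ K = 2) {L : ℝ}
    (hL : Tendsto (fun N : ℕ => ∑ n ∈ Finset.range N, (kroneckerChar (discr K) n : ℝ) / n)
      atTop (𝓝 L)) : 0 < L := by
  refine (dedekindZeta_residue_pos K).trans_le ?_
  have h := (Complex.continuous_re.tendsto _).comp
    ((tendsto_sub_one_mul_dedekindZeta_nhdsGT K).comp tendsto_one_add_nhdsGT)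
  rw [Complex.ofReal_re] at h
  refine le_of_tendsto_of_tendsto h (tendsto_mul_exp_tsum_primes hdeg hL) ?_
  filter_upwards [self_mem_nhdsWithin] with δ hδ
  have hδ' : (0 : ℝ) < δ := hδ
  have hs1 : (1 : ℝ) < 1 + δ := by linarith
  have hs : (0 : ℝ) < 1 + δ := by linarith
  have hb := sum_range_card_rpow_le hs (exp_tsum_primes hdeg hs1).1
  have hzeta : dedekindZeta K ((1 + δ : ℝ) : ℂ) =
      ((∑' n : ℕ, (Nat.card {I : Ideal (𝓞 K) // Ideal.absNorm I = n} : ℝ) *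
        (n : ℝ) ^ (-(1 + δ)) : ℝ) : ℂ) := by
    rw [dedekindZeta, LSeries, Complex.ofReal_tsum]
    refine tsum_congr fun n => ?_
    rcases eq_or_ne n 0 with rfl | hn
    · rw [LSeries.term_zero, Nat.cast_zero, Real.zero_rpow (by linarith), mul_zero,
        Complex.ofReal_zero]
    · rw [LSeries.term_of_ne_zero hn, Real.rpow_neg (Nat.cast_nonneg _), Complex.ofReal_mul,
        Complex.ofReal_inv, Complex.ofReal_cpow (Nat.cast_nonneg _), div_eq_mul_inv,
        Complex.ofReal_natCast, Complex.ofReal_natCast]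
  simp only [Function.comp_apply]
  rw [hzeta, ← Complex.ofReal_one, ← Complex.ofReal_sub, ← Complex.ofReal_mul, Complex.ofReal_re,
    add_sub_cancel_left]
  exact mul_le_mul_of_nonneg_left
    (Real.tsum_le_of_sum_range_le (fun n => by positivity) hb) hδ'.le

end DedekindZetaBound

section Mertens

open IsDedekindDomain

variable {K : Type*} [Field K] [NumberField K]

theorem mul_log_one_sub_le {q t : ℝ} (hq1 : q < 1) (ht0 : 0 ≤ t) (ht1 : t ≤ 1) :
    t * Real.log (1 - q) ≤ Real.log (1 - q * t) := by
  have h := (strictConcaveOn_log_Ioi.concaveOn).2 (x := 1 - q) (y := 1)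
    (by simpa using hq1) (by simp) ht0 (sub_nonneg.2 ht1) (by ring)
  simp only [smul_eq_mul, Real.log_one, mul_zero, add_zero, mul_one] at h
  rwa [show t * (1 - q) + (1 - t) = 1 - q * t by ring] at h

theorem log_one_sub_mul_sub_le {q t : ℝ} (hq0 : 0 ≤ q) (hq1 : q ≤ 1 / 2) (ht0 : 0 ≤ t)
    (ht1 : t ≤ 1) :
    Real.log (1 - q * t) - t * Real.log (1 - q) ≤ 2 * q ^ 2 := by
  have h1 : Real.log (1 - q * t) ≤ -(q * t) := by
    have := Real.log_le_sub_one_of_pos (x := 1 - q * t) (by nlinarith)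
    linarith
  have h2 : -(q + 2 * q ^ 2) ≤ Real.log (1 - q) := by
    have h := Real.one_sub_inv_le_log_of_pos (x := 1 - q) (by linarith)
    refine le_trans ?_ h
    have h3 : (1 - q)⁻¹ ≤ 1 + q + 2 * q ^ 2 := by
      rw [inv_le_iff_one_le_mul₀ (by linarith)]
      nlinarith [mul_nonneg (sq_nonneg q) (by linarith : (0 : ℝ) ≤ 1 / 2 - q)]
    linarith
  nlinarith [mul_le_mul_of_nonneg_left h2 ht0, sq_nonneg q]

theorem summable_inv_sq (hdeg : Module.finrank ℚ K = 2) :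
    Summable fun v : HeightOneSpectrum (𝓞 K) => ((Ideal.absNorm v.asIdeal : ℝ)⁻¹) ^ 2 := by
  refine .of_nonneg_of_le (fun v => by positivity) (fun v => ?_)
    (exp_tsum_primes hdeg one_lt_two).1
  have h1 := nat_rpow_neg_lt_one (one_lt_absNorm v) zero_lt_two
  have h2 := Real.log_le_sub_one_of_pos (sub_pos.2 h1)
  have h3 : (Ideal.absNorm v.asIdeal : ℝ) ^ (-2 : ℝ) = ((Ideal.absNorm v.asIdeal : ℝ)⁻¹) ^ 2 := by
    rw [Real.rpow_neg (Nat.cast_nonneg _), inv_pow]; norm_cast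
  rw [← h3]
  linarith

theorem logLaplace_primes (hdeg : Module.finrank ℚ K = 2) {L : ℝ}
    (hL : Tendsto (fun N : ℕ => ∑ n ∈ Finset.range N, (kroneckerChar (discr K) n : ℝ) / n)
      atTop (𝓝 L)) :
    LogLaplace (fun v : HeightOneSpectrum (𝓞 K) => -Real.log (1 - (Ideal.absNorm v.asIdeal : ℝ)⁻¹))
      (fun v => Real.log (Ideal.absNorm v.asIdeal)) (Real.log L) := by
  have hpos := kroneckerChar_series_pos hdeg hL
  have hN : ∀ v : HeightOneSpectrum (𝓞 K), (2 : ℝ) ≤ Ideal.absNorm v.asIdeal := fun v => by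
    exact_mod_cast one_lt_absNorm v
  have hq0 : ∀ v : HeightOneSpectrum (𝓞 K), 0 ≤ (Ideal.absNorm v.asIdeal : ℝ)⁻¹ := fun v => by
    positivity
  have hq1 : ∀ v : HeightOneSpectrum (𝓞 K), (Ideal.absNorm v.asIdeal : ℝ)⁻¹ ≤ 1 / 2 := fun v => by
    rw [one_div]; exact inv_anti₀ two_pos (hN v)
  have hexp : ∀ (δ : ℝ) (v : HeightOneSpectrum (𝓞 K)),
      Real.exp (-(δ * Real.log (Ideal.absNorm v.asIdeal))) =
        (Ideal.absNorm v.asIdeal : ℝ) ^ (-δ) := fun δ v => by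
    rw [Real.rpow_def_of_pos (by linarith [hN v])]; ring_nf
  have hmul : ∀ (δ : ℝ) (v : HeightOneSpectrum (𝓞 K)),
      (Ideal.absNorm v.asIdeal : ℝ) ^ (-(1 + δ)) =
        (Ideal.absNorm v.asIdeal : ℝ)⁻¹ * (Ideal.absNorm v.asIdeal : ℝ) ^ (-δ) := fun δ v => by
    rw [neg_add, Real.rpow_add (by linarith [hN v]), Real.rpow_neg_one]
  set D : ℝ → HeightOneSpectrum (𝓞 K) → ℝ := fun δ v =>
    Real.log (1 - (Ideal.absNorm v.asIdeal : ℝ) ^ (-(1 + δ))) -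
      (Ideal.absNorm v.asIdeal : ℝ) ^ (-δ) * Real.log (1 - (Ideal.absNorm v.asIdeal : ℝ)⁻¹) with hD
  have hDbound : ∀ δ > 0, ∀ v, ‖D δ v‖ ≤ 2 * ((Ideal.absNorm v.asIdeal : ℝ)⁻¹) ^ 2 := by
    intro δ hδ v
    have ht0 : 0 ≤ (Ideal.absNorm v.asIdeal : ℝ) ^ (-δ) := by positivity
    have ht1 : (Ideal.absNorm v.asIdeal : ℝ) ^ (-δ) ≤ 1 :=
      (nat_rpow_neg_lt_one (one_lt_absNorm v) hδ).le
    rw [hD]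
    simp only [hmul]
    rw [Real.norm_of_nonneg
      (sub_nonneg.2 (mul_log_one_sub_le (by linarith [hq1 v]) ht0 ht1))]
    exact log_one_sub_mul_sub_le (hq0 v) (hq1 v) ht0 ht1
  have hDsum : ∀ δ > 0, Summable (D δ) := fun δ hδ =>
    .of_norm_bounded ((summable_inv_sq hdeg).mul_left 2) (hDbound δ hδ)
  have hsplit : ∀ (δ : ℝ) (v : HeightOneSpectrum (𝓞 K)),
      -Real.log (1 - (Ideal.absNorm v.asIdeal : ℝ)⁻¹) *
        Real.exp (-(δ * Real.log (Ideal.absNorm v.asIdeal))) =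
      D δ v + -Real.log (1 - (Ideal.absNorm v.asIdeal : ℝ) ^ (-(1 + δ))) := fun δ v => by
    rw [hexp, hD]; ring
  have hZ : ∀ δ > (0 : ℝ), _ := fun δ hδ => (exp_tsum_primes hdeg (by linarith : 1 < 1 + δ)).1
  refine ⟨fun v => neg_log_one_sub_nonneg (hq0 v) (by linarith [hq1 v]),
    fun v => Real.log_nonneg (by linarith [hN v]), fun δ hδ => ?_, ?_⟩
  · simp only [hsplit]
    exact (hDsum δ hδ).add (hZ δ hδ)
  have hD0 : Tendsto (fun δ => ∑' v, D δ v) (𝓝[>] 0)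
      (𝓝 (∑' _ : HeightOneSpectrum (𝓞 K), (0 : ℝ))) := by
    refine tendsto_tsum_of_dominated_convergence ((summable_inv_sq hdeg).mul_left 2)
      (fun v => ?_) ?_
    · have hNv : (Ideal.absNorm v.asIdeal : ℝ) ≠ 0 := by linarith [hN v]
      have hc : ContinuousAt (fun δ => D δ v) 0 := by
        have h1 : ContinuousAt (fun δ : ℝ => (Ideal.absNorm v.asIdeal : ℝ) ^ (-δ)) 0 :=
          ((Real.continuous_const_rpow hNv).comp continuous_neg).continuousAt
        have h2 : ContinuousAt (fun δ : ℝ => (Ideal.absNorm v.asIdeal : ℝ) ^ (-(1 + δ))) 0 :=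
          ((Real.continuous_const_rpow hNv).comp
            (continuous_neg.comp (continuous_const.add continuous_id))).continuousAt
        refine ((continuousAt_const.sub h2).log ?_).sub (h1.mul continuousAt_const)
        change (1 : ℝ) - (Ideal.absNorm v.asIdeal : ℝ) ^ (-(1 + 0 : ℝ)) ≠ 0
        rw [add_zero, Real.rpow_neg_one]
        linarith [hq1 v]
      have h0 : D 0 v = 0 := by
        rw [hD]
        simp only [add_zero, neg_zero, Real.rpow_zero, Real.rpow_neg_one, one_mul, sub_self]
      have := hc.tendsto
      rw [h0] at this
      exact this.mono_left nhdsWithin_le_nhds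
    · filter_upwards [self_mem_nhdsWithin] with δ hδ v using hDbound δ hδ v
  have hlog := ((Real.continuousAt_log hpos.ne').tendsto.comp
    (tendsto_mul_exp_tsum_primes hdeg hL))
  have := hD0.add hlog
  rw [tsum_zero, zero_add] at this
  refine this.congr' ?_
  filter_upwards [self_mem_nhdsWithin] with δ hδ
  have hδ' : (0 : ℝ) < δ := hδ
  simp only [hsplit, Function.comp_apply]
  rw [(hDsum δ hδ).tsum_add (hZ δ hδ), Real.log_mul hδ'.ne' (Real.exp_pos _).ne', Real.log_exp]
  ring

/-- **Mertens' third theorem** for a quadratic field, in logarithmic form. -/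
theorem tendsto_mertens (hdeg : Module.finrank ℚ K = 2) {L : ℝ}
    (hL : Tendsto (fun N : ℕ => ∑ n ∈ Finset.range N, (kroneckerChar (discr K) n : ℝ) / n)
      atTop (𝓝 L)) :
    Tendsto (fun y => LogLaplace.mass
      (fun v : HeightOneSpectrum (𝓞 K) => -Real.log (1 - (Ideal.absNorm v.asIdeal : ℝ)⁻¹))
      (fun v => Real.log (Ideal.absNorm v.asIdeal)) y - Real.log y) atTop
      (𝓝 (Real.log L + Real.eulerMascheroniConstant)) :=
  (logLaplace_primes hdeg hL).tendsto_mass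

end Mertens

section UnitCount

open IsDedekindDomain

variable {K : Type*} [Field K] [NumberField K]

theorem card_units_mul_card_of_surjective {A k : Type*} [CommRing A] [Field k] [Finite A]
    (f : A →+* k) (hf : Function.Surjective f) (hu : ∀ a, IsUnit a ↔ f a ≠ 0) :
    (Nat.card Aˣ : ℝ) = Nat.card A * (1 - (Nat.card k : ℝ)⁻¹) := by
  classical
  have : Finite k := Finite.of_surjective f hf
  have h1 : Nat.card Aˣ = Nat.card {a : A // f a ≠ 0} := by
    refine Nat.card_congr ((Equiv.ofInjective _ Units.val_injective).trans
      (Equiv.subtypeEquivRight fun a => ?_))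
    rw [← hu a]
    rfl
  have h2 : Nat.card A = Nat.card {a : A // f a = 0} + Nat.card {a : A // f a ≠ 0} := by
    rw [← Nat.card_sum]
    exact Nat.card_congr (Equiv.sumCompl _).symm
  have h3 : Nat.card A = Nat.card k * Nat.card {a : A // f a = 0} := by
    rw [(f : A →+ k).ker.card_eq_card_quotient_mul_card_addSubgroup,
      Nat.card_congr (QuotientAddGroup.quotientKerEquivOfSurjective (f : A →+ k) hf).toEquiv]
    rfl
  have hk : (Nat.card k : ℝ) ≠ 0 := Nat.cast_ne_zero.2 Nat.card_pos.ne'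
  have h2' : (Nat.card A : ℝ) = Nat.card {a : A // f a = 0} + Nat.card {a : A // f a ≠ 0} := by
    exact_mod_cast h2
  have h3' : (Nat.card A : ℝ) = Nat.card k * Nat.card {a : A // f a = 0} := by exact_mod_cast h3
  rw [h1, mul_sub, mul_one, show (Nat.card A : ℝ) * (Nat.card k : ℝ)⁻¹ =
    Nat.card {a : A // f a = 0} by rw [h3']; field_simp]
  linarith

theorem card_units_quotient_pow (v : HeightOneSpectrum (𝓞 K)) {n : ℕ} (hn : n ≠ 0) :
    (Nat.card (𝓞 K ⧸ v.asIdeal ^ n)ˣ : ℝ) =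
      Ideal.absNorm (v.asIdeal ^ n) * (1 - (Ideal.absNorm v.asIdeal : ℝ)⁻¹) := by
  have hmax : v.asIdeal.IsMaximal := v.isMaximal
  let := Ideal.Quotient.field v.asIdeal
  have : Finite (𝓞 K ⧸ v.asIdeal ^ n) :=
    Ideal.finiteQuotientOfFreeOfNeBot _ (pow_ne_zero n v.ne_bot)
  refine card_units_mul_card_of_surjective (k := 𝓞 K ⧸ v.asIdeal)
    (Ideal.Quotient.factor (Ideal.pow_le_self hn)) (Ideal.Quotient.factor_surjective _) fun a => ?_
  obtain ⟨x, rfl⟩ := Ideal.Quotient.mk_surjective a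
  rw [Ideal.Quotient.isUnit_mk_pow_iff_notMem _ hn, Ideal.Quotient.factor_mk, ne_eq,
    Ideal.Quotient.eq_zero_iff_mem]

theorem card_units_quotient_prod (S : Finset (HeightOneSpectrum (𝓞 K)))
    (e : HeightOneSpectrum (𝓞 K) → ℕ) (he : ∀ v ∈ S, e v ≠ 0) :
    (Nat.card (𝓞 K ⧸ ∏ v ∈ S, v.asIdeal ^ e v)ˣ : ℝ) =
      Ideal.absNorm (∏ v ∈ S, v.asIdeal ^ e v) *
        ∏ v ∈ S, (1 - (Ideal.absNorm v.asIdeal : ℝ)⁻¹) := by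
  have hequiv := (Units.mapEquiv (HeightOneSpectrum.quotientEquivPiOfProdEq
    (∏ v ∈ S, v.asIdeal ^ e v) (fun v : S => v.1) (fun v => e v.1)
    (fun i j hij => Subtype.coe_injective.ne hij)
    (Finset.prod_coe_sort S fun v => v.asIdeal ^ e v)).toMulEquiv).trans MulEquiv.piUnits
  rw [Nat.card_congr hequiv.toEquiv, Nat.card_pi, map_prod, Nat.cast_prod, Nat.cast_prod,
    ← Finset.prod_mul_distrib, ← Finset.prod_coe_sort S]
  exact Finset.prod_congr rfl fun v _ => card_units_quotient_pow v.1 (he v.1 v.2)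

theorem exists_prod_pow_eq {I : Ideal (𝓞 K)} (hI : I ≠ ⊥) :
    ∃ (S : Finset (HeightOneSpectrum (𝓞 K))) (e : HeightOneSpectrum (𝓞 K) → ℕ),
      (∀ v ∈ S, e v ≠ 0) ∧ ∏ v ∈ S, v.asIdeal ^ e v = I := by
  classical
  obtain ⟨S, hS⟩ := exists_finset_prod_eq hI
  refine ⟨S.filter fun v => primeExponent v I ≠ 0, fun v => primeExponent v I,
    fun v hv => (Finset.mem_filter.1 hv).2, ?_⟩
  conv_rhs => rw [← hS S subset_rfl]
  refine Finset.prod_filter_of_ne (p := fun v => primeExponent v I ≠ 0) fun v _ hv h0 => hv ?_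
  simp only [h0, pow_zero]

end UnitCount

section Liminf

open IsDedekindDomain

theorem liminf_eq_of_eventually_ge_of_frequently_le {α : Type*} {F : Filter α} {f : α → ℝ} {c : ℝ}
    (hge : ∀ a < c, ∀ᶠ x in F, a ≤ f x) (hle : ∀ b > c, ∃ᶠ x in F, f x ≤ b) :
    liminf f F = c := by
  refine le_antisymm (le_of_forall_gt_imp_ge_of_dense fun b hb => ?_)
    (le_of_forall_lt_imp_le_of_dense fun a ha => ?_)
  · exact liminf_le_of_frequently_le (hle b hb)
      (isBoundedUnder_of_eventually_ge (hge (c - 1) (by linarith)))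
  · exact le_liminf_of_le (IsCoboundedUnder.of_frequently_le (hle (c + 1) (by linarith))) (hge a ha)

variable {K : Type*} [Field K] [NumberField K]

/-- The weight `-log (1 - 1 / N v)` of a prime `v`. -/
noncomputable def primeWeight (v : HeightOneSpectrum (𝓞 K)) : ℝ :=
  -Real.log (1 - (Ideal.absNorm v.asIdeal : ℝ)⁻¹)

/-- The logarithm of the norm of a prime. -/
noncomputable def primeLogNorm (v : HeightOneSpectrum (𝓞 K)) : ℝ :=
  Real.log (Ideal.absNorm v.asIdeal)

theorem two_le_absNorm_cast (v : HeightOneSpectrum (𝓞 K)) : (2 : ℝ) ≤ Ideal.absNorm v.asIdeal := by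
  exact_mod_cast one_lt_absNorm v

theorem inv_absNorm_le_half (v : HeightOneSpectrum (𝓞 K)) :
    (Ideal.absNorm v.asIdeal : ℝ)⁻¹ ≤ 1 / 2 := by
  rw [one_div]
  exact inv_anti₀ two_pos (two_le_absNorm_cast v)

theorem inv_absNorm_le_primeWeight (v : HeightOneSpectrum (𝓞 K)) :
    (Ideal.absNorm v.asIdeal : ℝ)⁻¹ ≤ primeWeight v := by
  have h := Real.log_le_sub_one_of_pos (x := 1 - (Ideal.absNorm v.asIdeal : ℝ)⁻¹)
    (by linarith [inv_absNorm_le_half v])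
  rw [primeWeight]
  linarith

theorem primeWeight_le (v : HeightOneSpectrum (𝓞 K)) :
    primeWeight v ≤ 2 * (Ideal.absNorm v.asIdeal : ℝ)⁻¹ := by
  have h0 : (0 : ℝ) ≤ (Ideal.absNorm v.asIdeal : ℝ)⁻¹ := by positivity
  have h1 := inv_absNorm_le_half v
  rw [primeWeight, ← Real.log_inv]
  refine (Real.log_le_sub_one_of_pos (inv_pos.2 (by linarith))).trans ?_
  rw [sub_le_iff_le_add, inv_le_iff_one_le_mul₀ (by linarith)]
  nlinarith

theorem primeWeight_nonneg (v : HeightOneSpectrum (𝓞 K)) : 0 ≤ primeWeight v :=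
  le_trans (by positivity) (inv_absNorm_le_primeWeight v)

theorem primeWeight_le_primeLogNorm (v : HeightOneSpectrum (𝓞 K)) :
    primeWeight v ≤ primeLogNorm v := by
  have h1 := inv_absNorm_le_half v
  rw [primeWeight, primeLogNorm, ← Real.log_inv]
  refine Real.log_le_log (inv_pos.2 (by linarith)) (le_trans ?_ (two_le_absNorm_cast v))
  rw [inv_le_iff_one_le_mul₀ (by linarith)]
  linarith

theorem exp_neg_primeWeight (v : HeightOneSpectrum (𝓞 K)) :
    Real.exp (-primeWeight v) = 1 - (Ideal.absNorm v.asIdeal : ℝ)⁻¹ := by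
  rw [primeWeight, neg_neg, Real.exp_log (by linarith [inv_absNorm_le_half v])]

theorem exp_primeLogNorm (v : HeightOneSpectrum (𝓞 K)) :
    Real.exp (primeLogNorm v) = Ideal.absNorm v.asIdeal :=
  Real.exp_log (by linarith [two_le_absNorm_cast v])

theorem finite_primeLogNorm_le (y : ℝ) :
    {v : HeightOneSpectrum (𝓞 K) | primeLogNorm v ≤ y}.Finite := by
  refine Set.Finite.of_finite_image (f := HeightOneSpectrum.asIdeal)
    ((Ideal.finite_setOfPred_absNorm_le (S := 𝓞 K) ⌊Real.exp y⌋₊).subset ?_)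
    (fun v _ w _ h => HeightOneSpectrum.ext h)
  rintro _ ⟨v, hv, rfl⟩
  refine Nat.le_floor ?_
  rw [← exp_primeLogNorm]
  exact Real.exp_le_exp.2 hv

variable (K) in
/-- The finite set of primes of norm at most `exp y`. -/
noncomputable def primesUpTo (y : ℝ) : Finset (HeightOneSpectrum (𝓞 K)) :=
  (finite_primeLogNorm_le y).toFinset

theorem mem_primesUpTo {y : ℝ} {v : HeightOneSpectrum (𝓞 K)} :
    v ∈ primesUpTo K y ↔ primeLogNorm v ≤ y := by
  simp [primesUpTo]

variable (K) in
/-- The logarithm of the inverse of `∏ (1 - 1 / N v)` over the primes of norm at most `exp y`. -/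
noncomputable def primeMass (y : ℝ) : ℝ :=
  LogLaplace.mass (primeWeight (K := K)) primeLogNorm y

variable (K) in
theorem primeMass_eq_sum (y : ℝ) : primeMass K y = ∑ v ∈ primesUpTo K y, primeWeight v := by
  rw [primeMass, LogLaplace.mass, tsum_eq_sum (s := primesUpTo K y)
    fun v hv => if_neg fun h => hv (mem_primesUpTo.2 h)]
  exact Finset.sum_congr rfl fun v hv => if_pos (mem_primesUpTo.1 hv)

theorem card_units_quotient_prod_div (S : Finset (HeightOneSpectrum (𝓞 K)))
    (e : HeightOneSpectrum (𝓞 K) → ℕ) (he : ∀ v ∈ S, e v ≠ 0) :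
    (Nat.card (𝓞 K ⧸ ∏ v ∈ S, v.asIdeal ^ e v)ˣ : ℝ) / Ideal.absNorm (∏ v ∈ S, v.asIdeal ^ e v) =
      Real.exp (-∑ v ∈ S, primeWeight v) := by
  have hne : (Ideal.absNorm (∏ v ∈ S, v.asIdeal ^ e v) : ℝ) ≠ 0 := by
    refine Nat.cast_ne_zero.2 (Ideal.absNorm_ne_zero_iff _ |>.2 ?_)
    exact Ideal.finiteQuotientOfFreeOfNeBot _ (Finset.prod_ne_zero_iff.2 fun v _ =>
      pow_ne_zero _ v.ne_bot)
  rw [card_units_quotient_prod S e he, mul_div_cancel_left₀ _ hne, ← Finset.sum_neg_distrib,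
    Real.exp_sum]
  exact Finset.prod_congr rfl fun v _ => (exp_neg_primeWeight v).symm

theorem log_absNorm_prod (S : Finset (HeightOneSpectrum (𝓞 K)))
    (e : HeightOneSpectrum (𝓞 K) → ℕ) :
    Real.log (Ideal.absNorm (∏ v ∈ S, v.asIdeal ^ e v)) = ∑ v ∈ S, e v * primeLogNorm v := by
  rw [map_prod, Nat.cast_prod, Real.log_prod fun v _ => by
    rw [map_pow, Nat.cast_pow]; exact pow_ne_zero _ (by linarith [two_le_absNorm_cast v])]
  refine Finset.sum_congr rfl fun v _ => ?_
  rw [map_pow, Nat.cast_pow, Real.log_pow, primeLogNorm]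

theorem primeLogNorm_nonneg (v : HeightOneSpectrum (𝓞 K)) : 0 ≤ primeLogNorm v :=
  (primeWeight_nonneg v).trans (primeWeight_le_primeLogNorm v)

theorem sum_primeWeight_le {S : Finset (HeightOneSpectrum (𝓞 K))} {y : ℝ} (hy : 0 < y)
    (hS : ∑ v ∈ S, primeLogNorm v ≤ Real.exp y) :
    ∑ v ∈ S, primeWeight v ≤ primeMass K y + 2 / y := by
  classical
  rw [← Finset.sum_filter_add_sum_filter_not S (fun v => primeLogNorm v ≤ y)]
  refine add_le_add ?_ ?_
  · rw [primeMass_eq_sum]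
    exact Finset.sum_le_sum_of_subset_of_nonneg
      (fun v hv => mem_primesUpTo.2 (Finset.mem_filter.1 hv).2) fun v _ _ => primeWeight_nonneg v
  · set T := S.filter fun v => ¬primeLogNorm v ≤ y with hT
    have hTy : ∀ v ∈ T, y < primeLogNorm v := fun v hv => not_le.1 (Finset.mem_filter.1 hv).2
    have hcard : T.card * y ≤ Real.exp y := by
      rw [← nsmul_eq_mul]
      refine (Finset.card_nsmul_le_sum T primeLogNorm y fun v hv => (hTy v hv).le).trans
        (le_trans ?_ hS)
      exact Finset.sum_le_sum_of_subset_of_nonneg (Finset.filter_subset _ _)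
        fun v _ _ => primeLogNorm_nonneg v
    have hw : ∀ v ∈ T, primeWeight v ≤ 2 * Real.exp (-y) := fun v hv => by
      refine (primeWeight_le v).trans ?_
      rw [← exp_primeLogNorm, ← Real.exp_neg]
      have := Real.exp_le_exp.2 (neg_le_neg (hTy v hv).le)
      linarith
    refine (Finset.sum_le_card_nsmul T _ _ hw).trans ?_
    rw [nsmul_eq_mul, le_div_iff₀ hy]
    have h1 : Real.exp y * Real.exp (-y) = 1 := by rw [← Real.exp_add]; simp
    nlinarith [mul_le_mul_of_nonneg_right hcard (Real.exp_pos (-y)).le]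

/-- The normalized Euler quotient `φ(I) log log N(I) / N(I)`. -/
noncomputable def eulerQuotient (I : Ideal (𝓞 K)) : ℝ :=
  (Nat.card (𝓞 K ⧸ I)ˣ : ℝ) * Real.log (Real.log (Ideal.absNorm I)) / (Ideal.absNorm I : ℝ)

theorem exp_le_eulerQuotient {I : Ideal (𝓞 K)} (hI : I ≠ ⊥) {y : ℝ} (hy : 0 < y)
    (hyI : Real.log (Real.log (Ideal.absNorm I)) = y) (hlog : 0 < Real.log (Ideal.absNorm I)) :
    Real.exp (-(primeMass K y - Real.log y) - 2 / y) ≤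
      eulerQuotient I := by
  obtain ⟨S, e, he, rfl⟩ := exists_prod_pow_eq hI
  rw [eulerQuotient, mul_div_right_comm, card_units_quotient_prod_div S e he, hyI]
  have hS : ∑ v ∈ S, primeLogNorm v ≤ Real.exp y := by
    rw [← hyI, Real.exp_log hlog, log_absNorm_prod]
    refine Finset.sum_le_sum fun v hv => ?_
    have h1 : (1 : ℝ) ≤ e v := by exact_mod_cast Nat.one_le_iff_ne_zero.2 (he v hv)
    nlinarith [primeLogNorm_nonneg v]
  have := sum_primeWeight_le hy hS
  conv_rhs => rw [← Real.exp_log hy, ← Real.exp_add]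
  refine Real.exp_le_exp.2 ?_
  linarith

variable (K) in
/-- The product of the primes of norm at most `exp y`. -/
noncomputable def primorialIdeal (y : ℝ) : Ideal (𝓞 K) :=
  ∏ v ∈ primesUpTo K y, v.asIdeal

variable (K) in
theorem primorialIdeal_eq_prod_pow (y : ℝ) :
    primorialIdeal K y = ∏ v ∈ primesUpTo K y,
      v.asIdeal ^ (fun _ => 1 : HeightOneSpectrum (𝓞 K) → ℕ) v := by
  simp only [pow_one, primorialIdeal]

variable (K) in
theorem primorialIdeal_ne_bot (y : ℝ) : primorialIdeal K y ≠ ⊥ :=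
  Finset.prod_ne_zero_iff.2 fun v _ => v.ne_bot

variable (K) in
theorem log_absNorm_primorialIdeal (y : ℝ) :
    Real.log (Ideal.absNorm (primorialIdeal K y)) = ∑ v ∈ primesUpTo K y, primeLogNorm v := by
  rw [primorialIdeal_eq_prod_pow, log_absNorm_prod]
  simp only [Nat.cast_one, one_mul]

variable (K) in
theorem card_units_primorialIdeal_div (y : ℝ) :
    (Nat.card (𝓞 K ⧸ primorialIdeal K y)ˣ : ℝ) / Ideal.absNorm (primorialIdeal K y) =
      Real.exp (-primeMass K y) := by
  rw [primorialIdeal_eq_prod_pow,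
    card_units_quotient_prod_div (primesUpTo K y) (fun _ => 1) fun _ _ => one_ne_zero,
    primeMass_eq_sum]

variable (K) in
theorem primeMass_le_log_absNorm_primorialIdeal (y : ℝ) :
    primeMass K y ≤
      Real.log (Ideal.absNorm (primorialIdeal K y)) := by
  rw [primeMass_eq_sum, log_absNorm_primorialIdeal]
  exact Finset.sum_le_sum fun v _ => primeWeight_le_primeLogNorm v

variable (K) in
theorem log_absNorm_primorialIdeal_le {y : ℝ} (hy : 0 ≤ y) :
    Real.log (Ideal.absNorm (primorialIdeal K y)) ≤
      y * (Real.exp y * primeMass K y) := by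
  rw [log_absNorm_primorialIdeal, primeMass_eq_sum, Finset.mul_sum, Finset.mul_sum]
  refine Finset.sum_le_sum fun v hv => ?_
  have h1 := mem_primesUpTo.1 hv
  have h2 : 1 ≤ Real.exp y * primeWeight v := by
    refine le_trans ?_ (mul_le_mul_of_nonneg_left (inv_absNorm_le_primeWeight v)
      (Real.exp_pos y).le)
    rw [← exp_primeLogNorm, ← Real.exp_neg, ← Real.exp_add]
    exact Real.one_le_exp (by linarith)
  nlinarith

variable (K) in
theorem eulerQuotient_primorialIdeal_le {y : ℝ} (hy : 0 < y) (hm : 0 < primeMass K y)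
    (hmy : primeMass K y ≤ y) :
    eulerQuotient (primorialIdeal K y) ≤
      Real.exp (-(primeMass K y - Real.log y)) * (1 + 2 * (Real.log y / y)) := by
  have hN := hm.trans_le (primeMass_le_log_absNorm_primorialIdeal K y)
  have h1 : Real.log (Real.log (Ideal.absNorm (primorialIdeal K y))) ≤ y + 2 * Real.log y := by
    refine (Real.log_le_log hN ((log_absNorm_primorialIdeal_le K hy.le).trans
      (mul_le_mul_of_nonneg_left (mul_le_mul_of_nonneg_left hmy (Real.exp_pos y).le) hy.le))).trans
      ?_
    rw [Real.log_mul hy.ne' (by positivity), Real.log_mul (Real.exp_pos y).ne' hy.ne', Real.log_exp]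
    linarith
  rw [eulerQuotient, mul_div_right_comm, card_units_primorialIdeal_div,
    neg_sub, sub_eq_neg_add, Real.exp_add, Real.exp_log hy, mul_assoc]
  refine mul_le_mul_of_nonneg_left (h1.trans_eq ?_) (Real.exp_pos _).le
  field_simp

theorem tendsto_primeMass (hdeg : Module.finrank ℚ K = 2) {L : ℝ}
    (hL : Tendsto (fun N : ℕ => ∑ n ∈ Finset.range N, (kroneckerChar (discr K) n : ℝ) / n)
      atTop (𝓝 L)) :
    Tendsto (fun y => primeMass K y - Real.log y) atTop
      (𝓝 (Real.log L + Real.eulerMascheroniConstant)) :=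
  tendsto_mertens hdeg hL

theorem tendsto_log_div_self : Tendsto (fun y => Real.log y / y) atTop (𝓝 0) :=
  Real.isLittleO_log_id_atTop.tendsto_div_nhds_zero

theorem liminf_eulerQuotient (hdeg : Module.finrank ℚ K = 2) {L : ℝ}
    (hL : Tendsto (fun N : ℕ => ∑ n ∈ Finset.range N, (kroneckerChar (discr K) n : ℝ) / n)
      atTop (𝓝 L)) :
    liminf (fun I : {I : Ideal (𝓞 K) // I ≠ ⊥} => eulerQuotient I.1)
      (comap (fun I : {I : Ideal (𝓞 K) // I ≠ ⊥} => Ideal.absNorm I.1) atTop) =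
      Real.exp (-Real.eulerMascheroniConstant) * L⁻¹ := by
  have hpos := kroneckerChar_series_pos hdeg hL
  have hm := tendsto_primeMass hdeg hL
  have hc : Real.exp (-Real.eulerMascheroniConstant) * L⁻¹ =
      Real.exp (-(Real.log L + Real.eulerMascheroniConstant)) := by
    rw [neg_add, Real.exp_add, Real.exp_neg (Real.log L), Real.exp_log hpos, mul_comm]
  rw [hc]
  refine liminf_eq_of_eventually_ge_of_frequently_le (fun a ha => ?_) fun b hb => ?_
  · have hlow : Tendsto (fun y => Real.exp (-(primeMass K y - Real.log y) - 2 / y)) atTop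
        (𝓝 (Real.exp (-(Real.log L + Real.eulerMascheroniConstant)))) := by
      have := (hm.neg.sub (tendsto_const_nhds.div_atTop tendsto_id :
        Tendsto (fun y : ℝ => 2 / y) atTop (𝓝 0))).rexp
      rwa [sub_zero] at this
    have hlog : Tendsto (fun I : {I : Ideal (𝓞 K) // I ≠ ⊥} => Real.log (Ideal.absNorm I.1))
        (comap (fun I : {I : Ideal (𝓞 K) // I ≠ ⊥} => Ideal.absNorm I.1) atTop) atTop :=
      Real.tendsto_log_atTop.comp (tendsto_natCast_atTop_atTop.comp tendsto_comap)
    have hloglog := Real.tendsto_log_atTop.comp hlog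
    filter_upwards [hlog.eventually_gt_atTop 0, hloglog.eventually_gt_atTop 0,
      hloglog.eventually (hlow.eventually_const_le ha)] with I h1 h2 h3
    exact h3.trans (exp_le_eulerQuotient I.2 h2 rfl h1)
  · have hupp : Tendsto (fun y => Real.exp (-(primeMass K y - Real.log y)) *
        (1 + 2 * (Real.log y / y))) atTop
        (𝓝 (Real.exp (-(Real.log L + Real.eulerMascheroniConstant)))) := by
      have := hm.neg.rexp.mul ((tendsto_log_div_self.const_mul 2).const_add 1)
      rwa [mul_zero, add_zero, mul_one] at this
    have hmtop : Tendsto (primeMass K) atTop atTop := by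
      have := hm.add_atTop Real.tendsto_log_atTop
      simpa only [sub_add_cancel] using this
    have hmle : ∀ᶠ y in atTop, primeMass K y ≤ y := by
      have h1 := (hm.div_atTop tendsto_id).add tendsto_log_div_self
      rw [add_zero] at h1
      filter_upwards [h1.eventually_le_const one_pos, eventually_gt_atTop 0] with y h hy
      rw [id, ← add_div, sub_add_cancel, div_le_one hy] at h
      exact h
    have hI : Tendsto (fun y => (⟨primorialIdeal K y, primorialIdeal_ne_bot K y⟩ :
        {I : Ideal (𝓞 K) // I ≠ ⊥})) atTop
        (comap (fun I : {I : Ideal (𝓞 K) // I ≠ ⊥} => Ideal.absNorm I.1) atTop) := by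
      refine tendsto_comap_iff.2 (tendsto_natCast_atTop_iff (R := ℝ) |>.1 ?_)
      refine tendsto_atTop_mono (fun y => ?_)
        (tendsto_atTop_mono (primeMass_le_log_absNorm_primorialIdeal K) hmtop)
      exact Real.log_le_self (Nat.cast_nonneg _)
    refine hI.frequently (Eventually.frequently ?_)
    filter_upwards [hmtop.eventually_gt_atTop 0, hmle, eventually_gt_atTop 0,
      hupp.eventually_le_const hb] with y h1 h2 h3 h4
    exact (eulerQuotient_primorialIdeal_le K h3 h1 h2).trans h4

end Liminf

end

/-- Let `K` be an imaginary quadratic field with discriminant `Δ_K`, associated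
quadratic character `χ = (Δ_K/·)`, and let `γ` be the Euler–Mascheroni constant.  If
`L = L(1,χ) = ∑_{n ≥ 1} χ(n)/n` (a conditionally convergent series, expressed as the limit of
its partial sums), then as nonzero ideals `𝔞` of `O_K` range over ideals with `|𝔞| → ∞`,
`liminf φ_K(𝔞) · log log |𝔞| / |𝔞| = e^{−γ} · L⁻¹`. -/
theorem liminf_phiK_loglog_div_norm (K : Type) [Field K] [NumberField K]
    (hdeg : Module.finrank ℚ K = 2) (him : IsEmpty (K →+* ℝ)) (L : ℝ)
    (hL : Filter.Tendsto
      (fun N : ℕ => ∑ n ∈ Finset.range N, (kroneckerChar (NumberField.discr K) n : ℝ) / n)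
      Filter.atTop (nhds L)) :
    Filter.liminf
      (fun 𝔞 : {I : Ideal (𝓞 K) // I ≠ ⊥} =>
        (Nat.card ((𝓞 K ⧸ 𝔞.1)ˣ) : ℝ) * Real.log (Real.log (Ideal.absNorm 𝔞.1)) /
          (Ideal.absNorm 𝔞.1 : ℝ))
      (Filter.comap (fun 𝔞 : {I : Ideal (𝓞 K) // I ≠ ⊥} => Ideal.absNorm 𝔞.1) Filter.atTop)
    = Real.exp (-Real.eulerMascheroniConstant) * L⁻¹ := by
  exact liminf_eulerQuotient hdeg hL
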